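/- Assume the relaxed-control exit-time setup with a nonempty compact metric control space A, closed nonempty target T ⊆ ℝ^N, and hypotheses (STCT), (H5), (H6). If w : ℝ^N → ℝ is continuous, is a viscosity solution of the HJBE sup_{m ∈ A^r} { −f^r(x,m)·Dw(x) − ℓ^r(x,m) } = 0 on ℝ^N ∖ T, is bounded from below, and satisfies w ≡ 0 on T, then w(x) = v(x) for all x ∈ ℝ^N. -/

import Mathlib

open MeasureTheory Set Filter Topology Metric
open scoped RealInnerProductSpace ENNReal

noncomputable section

/-- The set of relaxed controls: measurable families `t ↦ β t` of Radon probability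
measures on the control space `A` (measurability in the weak-* sense). -/
def IsRelaxedControl {A : Type*} [MetricSpace A] [MeasurableSpace A]
    (β : ℝ → Measure A) : Prop :=
  (∀ t, IsProbabilityMeasure (β t)) ∧
    ∀ g : C(A, ℝ), Measurable fun t => ∫ a, g a ∂(β t)

/-- `y` is the trajectory of `ẏ = f^r(y, β)` with `y 0 = x` (integral form). -/
def IsTrajectory {N : ℕ} {A : Type*} [MeasurableSpace A]
    (f : EuclideanSpace ℝ (Fin N) → A → EuclideanSpace ℝ (Fin N))
    (β : ℝ → Measure A) (x : EuclideanSpace ℝ (Fin N))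
    (y : ℝ → EuclideanSpace ℝ (Fin N)) : Prop :=
  y 0 = x ∧ Continuous y ∧
    ∀ t, 0 ≤ t → y t = x + ∫ s in (0:ℝ)..t, ∫ a, f (y s) a ∂(β s)

/-- The set of times `t ≥ 0` at which the trajectory `y` lies in the target `T`;
its infimum is the exit time `t_x(β)`, and `t_x(β) < ∞` iff this set is nonempty. -/
def exitTimes {N : ℕ} (T : Set (EuclideanSpace ℝ (Fin N)))
    (y : ℝ → EuclideanSpace ℝ (Fin N)) : Set ℝ :=
  {t : ℝ | 0 ≤ t ∧ y t ∈ T}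

/-- The running cost `∫₀^t ℓ^r(y(s), β(s)) ds`, as an extended nonnegative real. -/
def runCost {N : ℕ} {A : Type*} [MeasurableSpace A]
    (ℓ : EuclideanSpace ℝ (Fin N) → A → ℝ) (β : ℝ → Measure A)
    (y : ℝ → EuclideanSpace ℝ (Fin N)) (t : ℝ) : ℝ≥0∞ :=
  ∫⁻ s in Ioc (0:ℝ) t, ENNReal.ofReal (∫ a, ℓ (y s) a ∂(β s))

/-- The value function `v(x)` of the exit time problem, as an extended real
(`+∞` when no relaxed control brings `x` to the target in finite time). -/
def valueFn {N : ℕ} {A : Type*} [MetricSpace A] [MeasurableSpace A]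
    (T : Set (EuclideanSpace ℝ (Fin N))) (ℓ : EuclideanSpace ℝ (Fin N) → A → ℝ)
    (Y : EuclideanSpace ℝ (Fin N) → (ℝ → Measure A) → ℝ → EuclideanSpace ℝ (Fin N))
    (x : EuclideanSpace ℝ (Fin N)) : EReal :=
  sInf { c : EReal | ∃ β : ℝ → Measure A, IsRelaxedControl β ∧
      (exitTimes T (Y x β)).Nonempty ∧
      c = ((runCost ℓ β (Y x β) (sInf (exitTimes T (Y x β)))) : EReal) }

/-- Viscosity solution of `F(x, Dw(x)) = 0` on the open set `G`, via `C¹` test functions. -/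
def IsViscositySol {N : ℕ}
    (F : EuclideanSpace ℝ (Fin N) → EuclideanSpace ℝ (Fin N) → ℝ)
    (G : Set (EuclideanSpace ℝ (Fin N))) (w : EuclideanSpace ℝ (Fin N) → ℝ) : Prop :=
  (∀ γ : EuclideanSpace ℝ (Fin N) → ℝ, ContDiffOn ℝ 1 γ G → ∀ x₀ ∈ G,
      IsLocalMinOn (fun x => w x - γ x) G x₀ → 0 ≤ F x₀ (gradient γ x₀)) ∧
  (∀ γ : EuclideanSpace ℝ (Fin N) → ℝ, ContDiffOn ℝ 1 γ G → ∀ x₁ ∈ G,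
      IsLocalMaxOn (fun x => w x - γ x) G x₁ → F x₁ (gradient γ x₁) ≤ 0)

/-- The Hamiltonian `sup_{m ∈ A^r} { −f^r(x,m)·p − ℓ^r(x,m) }` of the HJBE. -/
def HJB {N : ℕ} {A : Type*} [MetricSpace A] [MeasurableSpace A]
    (f : EuclideanSpace ℝ (Fin N) → A → EuclideanSpace ℝ (Fin N))
    (ℓ : EuclideanSpace ℝ (Fin N) → A → ℝ)
    (x p : EuclideanSpace ℝ (Fin N)) : ℝ :=
  ⨆ m : ProbabilityMeasure A,
    (-(inner (𝕜 := ℝ) (∫ a, f x a ∂(m : Measure A)) p : ℝ) - ∫ a, ℓ x a ∂(m : Measure A))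

set_option linter.unusedSectionVars false
set_option linter.unusedVariables false

set_option linter.unusedSectionVars false
section Measurability
variable {A : Type*} [MetricSpace A] [CompactSpace A] [MeasurableSpace A] [BorelSpace A]

variable {G : Type*} [NormedAddCommGroup G] [NormedSpace ℝ G]

lemma cont_integrable {g : A → G} (hg : Continuous g) (m : Measure A) [IsFiniteMeasure m] :
    Integrable g m := by
  exact hg.integrable_of_hasCompactSupport (HasCompactSupport.of_compactSpace g)

lemma IsRelaxedControl.measurable {β : ℝ → Measure A} (hβ : IsRelaxedControl β) :
    Measurable β := by
  have := hβ.1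
  refine Measurable.measure_of_isPiSystem_of_isProbabilityMeasure
    (S := {s : Set A | IsClosed s}) ?_ ?_ ?_
  · rw [BorelSpace.measurable_eq (α := A), borel_eq_generateFrom_isClosed]
  · exact isPiSystem_isClosed
  · intro s hs
    have hs' : IsClosed s := hs
    refine ENNReal.measurable_of_tendsto (f := fun (n : ℕ) t =>
      ∫⁻ a, hs'.apprSeq n a ∂(β t)) ?_ (tendsto_pi_nhds.2 fun t =>
        HasOuterApproxClosed.tendsto_lintegral_apprSeq hs' (β t))
    intro n
    have h1 := ENNReal.measurable_ofReal.comp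
      (hβ.2 ⟨fun a => (hs'.apprSeq n a : ℝ), by fun_prop⟩)
    convert h1 using 1
    ext t
    simp only [Function.comp, ContinuousMap.coe_mk]
    rw [ofReal_integral_eq_lintegral_ofReal]
    · simp
    · have : Continuous fun a => (hs'.apprSeq n a : ℝ) := by fun_prop
      exact cont_integrable this _
    · exact Eventually.of_forall fun a => by simp

/-- The kernel associated with a relaxed control. -/
def relKernel (β : ℝ → Measure A) (hβ : IsRelaxedControl β) : ProbabilityTheory.Kernel ℝ A :=
  ⟨β, hβ.measurable⟩

lemma relKernel_markov (β : ℝ → Measure A) (hβ : IsRelaxedControl β) :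
    ProbabilityTheory.IsMarkovKernel (relKernel β hβ) := ⟨hβ.1⟩

lemma relInt_stronglyMeasurable {β : ℝ → Measure A} (hβ : IsRelaxedControl β)
    {g : ℝ → A → G} (hg : Continuous (Function.uncurry g)) :
    StronglyMeasurable (fun s => ∫ a, g s a ∂(β s)) := by
  have := relKernel_markov β hβ
  exact StronglyMeasurable.integral_kernel_prod_right (κ := relKernel β hβ)
    (f := g) hg.stronglyMeasurable

lemma norm_relInt_le {m : Measure A} [IsProbabilityMeasure m] {g : A → G} {C : ℝ}
    (hC : ∀ a, ‖g a‖ ≤ C) : ‖∫ a, g a ∂m‖ ≤ C := by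
  have := norm_integral_le_of_norm_le_const (μ := m) (Eventually.of_forall hC)
  simpa using this

lemma exists_bound_compact {X : Type*} [TopologicalSpace X] {K : Set X} (hK : IsCompact K)
    {g : X → A → G} (hg : Continuous (Function.uncurry g)) :
    ∃ C, 0 ≤ C ∧ ∀ x ∈ K, ∀ a, ‖g x a‖ ≤ C := by
  obtain ⟨C, hC⟩ := (hK.prod (isCompact_univ (X := A))).exists_bound_of_continuousOn
    hg.continuousOn
  exact ⟨max C 0, le_max_right _ _, fun x hx a => (hC (x, a) ⟨hx, mem_univ _⟩).trans
    (le_max_left _ _)⟩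

lemma relInt_intervalIntegrable {β : ℝ → Measure A} (hβ : IsRelaxedControl β)
    {g : ℝ → A → G} (hg : Continuous (Function.uncurry g)) (s t : ℝ) :
    IntervalIntegrable (fun s => ∫ a, g s a ∂(β s)) volume s t := by
  obtain ⟨C, hC0, hC⟩ := exists_bound_compact (isCompact_uIcc (a := s) (b := t)) hg
  have : IntervalIntegrable (fun _ : ℝ => C) volume s t := intervalIntegrable_const
  refine this.mono_fun (relInt_stronglyMeasurable hβ hg).aestronglyMeasurable ?_
  refine (ae_restrict_iff' measurableSet_uIoc).2 (Eventually.of_forall fun r hr => ?_)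
  have := hβ.1 r
  rw [Real.norm_of_nonneg hC0]
  exact norm_relInt_le (hC r (uIoc_subset_uIcc hr))
end Measurability

/-- Integral form of the Gronwall inequality. -/
lemma gronwall_int {φ : ℝ → ℝ} (hφ : Continuous φ) {c L b : ℝ} (hL : 0 < L)
    (h : ∀ t ∈ Icc 0 b, φ t ≤ c + L * ∫ s in (0:ℝ)..t, φ s) :
    ∀ t ∈ Icc 0 b, φ t ≤ c * Real.exp (L * t) := by
  intro t ht
  have hd : ∀ x, HasDerivAt (fun t => ∫ s in (0:ℝ)..t, φ s) (φ x) x := fun x =>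
    intervalIntegral.integral_hasDerivAt_right (hφ.intervalIntegrable _ _)
      hφ.stronglyMeasurable.stronglyMeasurableAtFilter hφ.continuousAt
  have := le_gronwallBound_of_liminf_deriv_right_le (f := fun t => ∫ s in (0:ℝ)..t, φ s)
    (f' := φ) (δ := 0) (K := L) (ε := c) (a := 0) (b := b)
    (fun x _ => (hd x).continuousAt.continuousWithinAt)
    (fun x _ r hr => (hd x).hasDerivWithinAt.liminf_right_slope_le hr) (by simp)
    (fun x hx => by have := h x ⟨hx.1, hx.2.le⟩; linarith) t ht
  have h2 := h t ht
  rw [gronwallBound_of_K_ne_0 hL.ne'] at this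
  simp only [zero_mul, sub_zero, zero_add] at this
  have h3 : L * (∫ s in (0:ℝ)..t, φ s) ≤ c * (Real.exp (L * t) - 1) := by
    calc _ ≤ L * (c / L * (Real.exp (L * t) - 1)) := by gcongr
      _ = _ := by field_simp
  linarith

/-- Bundled standing assumptions on the dynamics. -/
structure Sys {N : ℕ} {A : Type*} [MetricSpace A] [MeasurableSpace A]
    (f : EuclideanSpace ℝ (Fin N) → A → EuclideanSpace ℝ (Fin N)) (L : ℝ)
    (Y : EuclideanSpace ℝ (Fin N) → (ℝ → Measure A) → ℝ → EuclideanSpace ℝ (Fin N)) : Prop where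
  cont : Continuous fun q : EuclideanSpace ℝ (Fin N) × A => f q.1 q.2
  pos : 0 < L
  lip : ∀ x y a, ‖f x a - f y a‖ ≤ L * ‖x - y‖
  traj : ∀ x β, IsRelaxedControl β → IsTrajectory f β x (Y x β)

/-- Real-valued running cost. -/
def rcost {N : ℕ} {A : Type*} [MeasurableSpace A]
    (c : EuclideanSpace ℝ (Fin N) → A → ℝ) (β : ℝ → Measure A)
    (y : ℝ → EuclideanSpace ℝ (Fin N)) (t : ℝ) : ℝ :=
  ∫ s in (0:ℝ)..t, ∫ a, c (y s) a ∂(β s)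

section Dynamics
variable {N : ℕ} {A : Type*} [MetricSpace A] [CompactSpace A] [MeasurableSpace A] [BorelSpace A]
  {f : EuclideanSpace ℝ (Fin N) → A → EuclideanSpace ℝ (Fin N)} {L : ℝ}
  {Y : EuclideanSpace ℝ (Fin N) → (ℝ → Measure A) → ℝ → EuclideanSpace ℝ (Fin N)}
  {G : Type*} [NormedAddCommGroup G] [NormedSpace ℝ G]

lemma comp_cont {c : EuclideanSpace ℝ (Fin N) → A → G}
    (hc : Continuous fun q : EuclideanSpace ℝ (Fin N) × A => c q.1 q.2)
    {y : ℝ → EuclideanSpace ℝ (Fin N)} (hy : Continuous y) :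
    Continuous (Function.uncurry fun s a => c (y s) a) :=
  hc.comp ((hy.comp continuous_fst).prodMk continuous_snd)

lemma slice_cont {X : Type*} [TopologicalSpace X] {c : X → A → G}
    (hc : Continuous fun q : X × A => c q.1 q.2) (x : X) :
    Continuous (c x) :=
  hc.comp (continuous_const.prodMk continuous_id)

lemma rel_ii {c : EuclideanSpace ℝ (Fin N) → A → G}
    (hc : Continuous fun q : EuclideanSpace ℝ (Fin N) × A => c q.1 q.2)
    {β : ℝ → Measure A} (hβ : IsRelaxedControl β)
    {y : ℝ → EuclideanSpace ℝ (Fin N)} (hy : Continuous y) (s t : ℝ) :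
    IntervalIntegrable (fun s => ∫ a, c (y s) a ∂(β s)) volume s t :=
  relInt_intervalIntegrable hβ (comp_cont hc hy) s t

lemma relInt_sub_le (S : Sys f L Y) {m : Measure A} [IsProbabilityMeasure m]
    (x y : EuclideanSpace ℝ (Fin N)) :
    ‖(∫ a, f x a ∂m) - ∫ a, f y a ∂m‖ ≤ L * ‖x - y‖ := by
  rw [← integral_sub (cont_integrable (slice_cont S.cont x) m)
    (cont_integrable (slice_cont S.cont y) m)]
  exact norm_relInt_le fun a => S.lip x y a

/-- Locality and uniqueness. -/
lemma traj_unique (S : Sys f L Y) {β β' : ℝ → Measure A} (hβ : IsRelaxedControl β)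
    (hβ' : IsRelaxedControl β') {h : ℝ} (heq : ∀ s ∈ Ico 0 h, β s = β' s)
    {x : EuclideanSpace ℝ (Fin N)} {y y' : ℝ → EuclideanSpace ℝ (Fin N)}
    (hy : Continuous y) (hy' : Continuous y')
    (e : ∀ t ∈ Icc 0 h, y t = x + ∫ s in (0:ℝ)..t, ∫ a, f (y s) a ∂(β s))
    (e' : ∀ t ∈ Icc 0 h, y' t = x + ∫ s in (0:ℝ)..t, ∫ a, f (y' s) a ∂(β' s)) :
    ∀ t ∈ Icc 0 h, y t = y' t := by
  have key := gronwall_int (φ := fun t => ‖y t - y' t‖) (by fun_prop) (c := 0) (b := h) S.pos ?_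
  · intro t ht
    have := key t ht
    rw [zero_mul] at this
    exact sub_eq_zero.1 (norm_le_zero_iff.1 this)
  · intro t ht
    rw [e t ht, e' t ht, add_sub_add_left_eq_sub,
      ← intervalIntegral.integral_sub (rel_ii S.cont hβ hy _ _) (rel_ii S.cont hβ' hy' _ _),
      zero_add, ← intervalIntegral.integral_const_mul]
    refine intervalIntegral.norm_integral_le_of_norm_le ht.1 ?_ ?_
    · have hne : ∀ᵐ s : ℝ, s ≠ h := by
        simp [ae_iff, measure_singleton]
      filter_upwards [hne] with s hs hs'
      have hs2 : s ∈ Ico 0 h := ⟨hs'.1.le, lt_of_le_of_ne (hs'.2.trans ht.2) hs⟩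
      have := hβ.1 s
      rw [← heq s hs2]
      exact relInt_sub_le S _ _
    · apply Continuous.intervalIntegrable
      fun_prop

lemma Sys.local (S : Sys f L Y) {β β' : ℝ → Measure A} (hβ : IsRelaxedControl β)
    (hβ' : IsRelaxedControl β') {h : ℝ} (heq : ∀ s ∈ Ico 0 h, β s = β' s)
    (x : EuclideanSpace ℝ (Fin N)) : ∀ t ∈ Icc 0 h, Y x β t = Y x β' t :=
  traj_unique S hβ hβ' heq (S.traj x β hβ).2.1 (S.traj x β' hβ').2.1
    (fun t ht => (S.traj x β hβ).2.2 t ht.1) (fun t ht => (S.traj x β' hβ').2.2 t ht.1)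

lemma relaxed_shift {β : ℝ → Measure A} (hβ : IsRelaxedControl β) (t : ℝ) :
    IsRelaxedControl (fun s => β (t + s)) :=
  ⟨fun s => hβ.1 _, fun g => (hβ.2 g).comp (measurable_const_add t)⟩

lemma traj_diff (S : Sys f L Y) {β : ℝ → Measure A} (hβ : IsRelaxedControl β)
    (x : EuclideanSpace ℝ (Fin N)) {s t : ℝ} (hs : 0 ≤ s) (ht : 0 ≤ t) :
    Y x β t = Y x β s + ∫ r in s..t, ∫ a, f (Y x β r) a ∂(β r) := by
  have h := S.traj x β hβ
  rw [h.2.2 t ht, h.2.2 s hs, add_assoc, intervalIntegral.integral_add_adjacent_intervals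
    (rel_ii S.cont hβ h.2.1 _ _) (rel_ii S.cont hβ h.2.1 _ _)]

lemma Sys.shift (S : Sys f L Y) {β : ℝ → Measure A} (hβ : IsRelaxedControl β)
    (x : EuclideanSpace ℝ (Fin N)) {t : ℝ} (ht : 0 ≤ t) {s : ℝ} (hs : 0 ≤ s) :
    Y x β (t + s) = Y (Y x β t) (fun s => β (t + s)) s := by
  have h := S.traj x β hβ
  have h2 := S.traj (Y x β t) _ (relaxed_shift hβ t)
  refine traj_unique S (h := s) (y := fun s => Y x β (t + s)) (relaxed_shift hβ t)
    (relaxed_shift hβ t) (fun _ _ => rfl) (h.2.1.comp (by fun_prop)) h2.2.1 ?_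
    (fun t ht => h2.2.2 t ht.1) s ⟨hs, le_rfl⟩
  intro r hr
  rw [traj_diff S hβ x ht (add_nonneg ht hr.1)]
  congr 1
  rw [intervalIntegral.integral_comp_add_left (fun r => ∫ a, f (Y x β r) a ∂(β r)) t, add_zero]

lemma Sys.zero (S : Sys f L Y) {β : ℝ → Measure A} (hβ : IsRelaxedControl β)
    (x : EuclideanSpace ℝ (Fin N)) : Y x β 0 = x := (S.traj x β hβ).1

lemma Sys.cty (S : Sys f L Y) {β : ℝ → Measure A} (hβ : IsRelaxedControl β)
    (x : EuclideanSpace ℝ (Fin N)) : Continuous (Y x β) := (S.traj x β hβ).2.1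

lemma Sys.growth (S : Sys f L Y) (R b : ℝ) (hb : 0 ≤ b) : ∃ R', ∀ x, ‖x‖ ≤ R → ∀ β,
    IsRelaxedControl β → ∀ t ∈ Icc 0 b, ‖Y x β t‖ ≤ R' := by
  obtain ⟨C, hC0, hC⟩ := exists_bound_compact (isCompact_singleton
    (x := (0 : EuclideanSpace ℝ (Fin N)))) (g := f) S.cont
  refine ⟨(|R| + C * b) * Real.exp (L * b), fun x hx β hβ t ht => ?_⟩
  have hyc := S.cty hβ x
  have key := gronwall_int (φ := fun t => ‖Y x β t‖) (by fun_prop) (c := |R| + C * b) (b := b)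
    S.pos ?_ t ht
  · refine key.trans ?_
    have := S.pos
    have := ht.2
    gcongr
  · intro t ht
    rw [(S.traj x β hβ).2.2 t ht.1]
    refine (norm_add_le _ _).trans ?_
    have h1 : ‖∫ s in (0:ℝ)..t, ∫ a, f (Y x β s) a ∂(β s)‖ ≤
        ∫ s in (0:ℝ)..t, (C + L * ‖Y x β s‖) := by
      refine intervalIntegral.norm_integral_le_of_norm_le ht.1 ?_ ?_
      · refine Eventually.of_forall fun s _ => ?_
        have := hβ.1 s
        refine norm_relInt_le fun a => ?_
        have h2 := hC 0 rfl a
        have h3 := S.lip (Y x β s) 0 a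
        rw [sub_zero] at h3
        calc ‖f (Y x β s) a‖ = ‖f 0 a + (f (Y x β s) a - f 0 a)‖ := by rw [add_sub_cancel]
          _ ≤ _ := (norm_add_le _ _).trans (add_le_add h2 h3)
      · apply Continuous.intervalIntegrable
        fun_prop
    rw [intervalIntegral.integral_add (by simp) (by apply Continuous.intervalIntegrable; fun_prop),
      intervalIntegral.integral_const_mul, intervalIntegral.integral_const] at h1
    simp only [sub_zero, smul_eq_mul] at h1
    have h4 : t * C ≤ C * b := by rw [mul_comm]; exact mul_le_mul_of_nonneg_left ht.2 hC0
    have := le_abs_self R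
    linarith

/-- Additivity of cost. -/
lemma rcost_shift (S : Sys f L Y) {c : EuclideanSpace ℝ (Fin N) → A → ℝ}
    (hc : Continuous fun q : EuclideanSpace ℝ (Fin N) × A => c q.1 q.2)
    {β : ℝ → Measure A} (hβ : IsRelaxedControl β)
    (x : EuclideanSpace ℝ (Fin N)) {t : ℝ} (ht : 0 ≤ t) {s : ℝ} (hs : 0 ≤ s) :
    rcost c β (Y x β) (t + s) = rcost c β (Y x β) t +
      rcost c (fun s => β (t + s)) (Y (Y x β t) (fun s => β (t + s))) s := by
  unfold rcost
  have hy := S.cty hβ x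
  rw [← intervalIntegral.integral_add_adjacent_intervals (b := t)
    (rel_ii hc hβ hy _ _) (rel_ii hc hβ hy _ _)]
  congr 1
  have := intervalIntegral.integral_comp_add_left (a := 0) (b := s)
    (fun r => ∫ a, c (Y x β r) a ∂(β r)) t
  rw [add_zero] at this
  rw [← this]
  refine intervalIntegral.integral_congr fun r hr => ?_
  rw [uIcc_of_le hs] at hr
  dsimp only
  rw [S.shift hβ x ht hr.1]

lemma rcost_local (S : Sys f L Y) (c : EuclideanSpace ℝ (Fin N) → A → ℝ)
    {β β' : ℝ → Measure A} (hβ : IsRelaxedControl β)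
    (hβ' : IsRelaxedControl β') {h : ℝ} (heq : ∀ s ∈ Ico 0 h, β s = β' s)
    (x : EuclideanSpace ℝ (Fin N)) {t : ℝ} (ht : t ∈ Icc 0 h) :
    rcost c β (Y x β) t = rcost c β' (Y x β') t := by
  unfold rcost
  refine intervalIntegral.integral_congr_ae ?_
  have hne : ∀ᵐ s : ℝ, s ≠ h := by
    simp [ae_iff, measure_singleton]
  filter_upwards [hne] with s hs hs'
  rw [uIoc_of_le ht.1] at hs'
  have hs2 : s ∈ Ico 0 h := ⟨hs'.1.le, lt_of_le_of_ne (hs'.2.trans ht.2) hs⟩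
  rw [S.local hβ hβ' heq x s ⟨hs2.1, hs2.2.le⟩, heq s hs2]

lemma relInt_nonneg {ℓ : EuclideanSpace ℝ (Fin N) → A → ℝ} (hnn : ∀ x a, 0 ≤ ℓ x a)
    (x : EuclideanSpace ℝ (Fin N)) (m : Measure A) : 0 ≤ ∫ a, ℓ x a ∂m :=
  integral_nonneg fun a => hnn x a

lemma runCost_eq {ℓ : EuclideanSpace ℝ (Fin N) → A → ℝ}
    (hc : Continuous fun q : EuclideanSpace ℝ (Fin N) × A => ℓ q.1 q.2)
    (hnn : ∀ x a, 0 ≤ ℓ x a)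
    {β : ℝ → Measure A} (hβ : IsRelaxedControl β)
    {y : ℝ → EuclideanSpace ℝ (Fin N)} (hy : Continuous y) {t : ℝ} (ht : 0 ≤ t) :
    runCost ℓ β y t = ENNReal.ofReal (rcost ℓ β y t) := by
  unfold runCost rcost
  rw [intervalIntegral.integral_of_le ht, ofReal_integral_eq_lintegral_ofReal]
  · exact (rel_ii hc hβ hy 0 t).1
  · exact Eventually.of_forall fun s => relInt_nonneg hnn _ _

lemma rcost_nonneg {ℓ : EuclideanSpace ℝ (Fin N) → A → ℝ}
    (hnn : ∀ x a, 0 ≤ ℓ x a) {β : ℝ → Measure A}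
    {y : ℝ → EuclideanSpace ℝ (Fin N)} {t : ℝ} (ht : 0 ≤ t) :
    0 ≤ rcost ℓ β y t :=
  intervalIntegral.integral_nonneg ht fun s _ => relInt_nonneg hnn _ _

end Dynamics

/-- Concatenation of two controls. -/
def cat {A : Type*} [MeasurableSpace A] (t : ℝ) (β β' : ℝ → Measure A) : ℝ → Measure A :=
  fun s => if s < t then β s else β' (s - t)

/-- Concatenation of a sequence of controls, each used for a time `h`. -/
def icat {A : Type*} [MeasurableSpace A] (h : ℝ) (β : ℕ → ℝ → Measure A) : ℝ → Measure A :=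
  fun s => β ⌊s / h⌋₊ (s - ⌊s / h⌋₊ * h)

section Concat
variable {N : ℕ} {A : Type*} [MetricSpace A] [CompactSpace A] [MeasurableSpace A] [BorelSpace A]
  {f : EuclideanSpace ℝ (Fin N) → A → EuclideanSpace ℝ (Fin N)} {L : ℝ}
  {Y : EuclideanSpace ℝ (Fin N) → (ℝ → Measure A) → ℝ → EuclideanSpace ℝ (Fin N)}

lemma cat_relaxed (t : ℝ) {β β' : ℝ → Measure A} (hβ : IsRelaxedControl β)
    (hβ' : IsRelaxedControl β') : IsRelaxedControl (cat t β β') := by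
  constructor
  · intro s
    unfold cat
    split_ifs
    exacts [hβ.1 _, hβ'.1 _]
  · intro g
    have : (fun s => ∫ a, g a ∂(cat t β β' s)) =
        fun s => if s < t then ∫ a, g a ∂(β s) else ∫ a, g a ∂(β' (s - t)) := by
      ext s; unfold cat; split_ifs <;> rfl
    rw [this]
    exact Measurable.ite measurableSet_Iio (hβ.2 g) ((hβ'.2 g).comp (measurable_sub_const t))

lemma icat_relaxed (h : ℝ) {β : ℕ → ℝ → Measure A} (hβ : ∀ k, IsRelaxedControl (β k)) :
    IsRelaxedControl (icat h β) := by
  constructor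
  · intro s
    exact (hβ _).1 _
  · intro g
    have h1 : Measurable (fun q : ℕ × ℝ => ∫ a, g a ∂(β q.1 (q.2 - q.1 * h))) := by
      refine measurable_from_prod_countable_right fun k => ?_
      exact ((hβ k).2 g).comp (measurable_sub_const (k * h))
    have h2 : Measurable (fun s : ℝ => (⌊s / h⌋₊, s)) :=
      (Nat.measurable_floor.comp (measurable_id.div_const h)).prodMk measurable_id
    exact h1.comp h2

lemma icat_eq {h : ℝ} (hh : 0 < h) (β : ℕ → ℝ → Measure A) (k : ℕ) {s : ℝ} (hs : s ∈ Ico 0 h) :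
    icat h β (k * h + s) = β k s := by
  have : ⌊(k * h + s) / h⌋₊ = k := by
    rw [Nat.floor_eq_iff (by have := hs.1; positivity)]
    constructor
    · rw [le_div_iff₀ hh]; linarith [hs.1]
    · rw [div_lt_iff₀ hh]; linarith [hs.2]
  unfold icat
  rw [this]
  congr 1
  ring

lemma cat_traj (S : Sys f L Y) {t : ℝ} (ht : 0 ≤ t) {β β' : ℝ → Measure A}
    (hβ : IsRelaxedControl β) (hβ' : IsRelaxedControl β') {c : EuclideanSpace ℝ (Fin N) → A → ℝ}
    (hc : Continuous fun q : EuclideanSpace ℝ (Fin N) × A => c q.1 q.2)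
    (x : EuclideanSpace ℝ (Fin N)) {s : ℝ} (hs : 0 ≤ s) :
    Y x (cat t β β') (t + s) = Y (Y x β t) β' s ∧
    rcost c (cat t β β') (Y x (cat t β β')) (t + s) =
      rcost c β (Y x β) t + rcost c β' (Y (Y x β t) β') s := by
  have hr := cat_relaxed t hβ hβ'
  have e1 : ∀ s ∈ Ico 0 t, cat t β β' s = β s := fun s hs => by simp [cat, hs.2]
  have e2 : ∀ r ∈ Ico 0 s, (fun s => cat t β β' (t + s)) r = β' r := fun r hr => by
    simp [cat, hr.1]
  have e3 := S.local hr hβ e1 x t ⟨ht, le_rfl⟩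
  constructor
  · rw [S.shift hr x ht hs, S.local (relaxed_shift hr t) hβ' e2 _ s ⟨hs, le_rfl⟩, e3]
  · rw [rcost_shift S hc hr x ht hs, rcost_local S c (relaxed_shift hr t) hβ' e2 _ ⟨hs, le_rfl⟩,
      rcost_local S c hr hβ e1 x ⟨ht, le_rfl⟩, e3]

lemma icat_traj (S : Sys f L Y) {h : ℝ} (hh : 0 < h) {β : ℕ → ℝ → Measure A}
    (hβ : ∀ k, IsRelaxedControl (β k)) {c : EuclideanSpace ℝ (Fin N) → A → ℝ}
    (hc : Continuous fun q : EuclideanSpace ℝ (Fin N) × A => c q.1 q.2)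
    {xs : ℕ → EuclideanSpace ℝ (Fin N)} (hxs : ∀ k, xs (k + 1) = Y (xs k) (β k) h) (k : ℕ) :
    Y (xs 0) (icat h β) (k * h) = xs k ∧ ∀ s ∈ Icc 0 h,
    Y (xs 0) (icat h β) (k * h + s) = Y (xs k) (β k) s ∧
    rcost c (icat h β) (Y (xs 0) (icat h β)) (k * h + s) =
      rcost c (icat h β) (Y (xs 0) (icat h β)) (k * h) + rcost c (β k) (Y (xs k) (β k)) s := by
  have hr := icat_relaxed h hβ
  have main : ∀ k : ℕ, Y (xs 0) (icat h β) (k * h) = xs k → ∀ s ∈ Icc 0 h,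
    Y (xs 0) (icat h β) (k * h + s) = Y (xs k) (β k) s ∧
    rcost c (icat h β) (Y (xs 0) (icat h β)) (k * h + s) =
      rcost c (icat h β) (Y (xs 0) (icat h β)) (k * h) + rcost c (β k) (Y (xs k) (β k)) s := by
    intro k hk s hs
    have hkh : (0:ℝ) ≤ k * h := by positivity
    have e : ∀ s ∈ Ico 0 h, (fun s => icat h β (k * h + s)) s = β k s :=
      fun s hs => icat_eq hh β k hs
    constructor
    · rw [S.shift hr _ hkh hs.1, S.local (relaxed_shift hr _) (hβ k) e _ s hs, hk]
    · rw [rcost_shift S hc hr _ hkh hs.1, rcost_local S c (relaxed_shift hr _) (hβ k) e _ hs, hk]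
  have h0 : Y (xs 0) (icat h β) (k * h) = xs k := by
    induction k with
    | zero => simpa using S.zero hr _
    | succ k ih =>
      rw [hxs k, ← (main k ih h ⟨hh.le, le_rfl⟩).1]
      congr 1
      push_cast
      ring
  exact ⟨h0, main k h0⟩
end Concat

section Core
variable {N : ℕ} {A : Type*} [MetricSpace A] [CompactSpace A] [MeasurableSpace A] [BorelSpace A]
  {f : EuclideanSpace ℝ (Fin N) → A → EuclideanSpace ℝ (Fin N)} {L : ℝ}
  {Y : EuclideanSpace ℝ (Fin N) → (ℝ → Measure A) → ℝ → EuclideanSpace ℝ (Fin N)}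

/-- One step of the discretized estimate. -/
lemma step_est (S : Sys f L Y) {c : EuclideanSpace ℝ (Fin N) → A → ℝ}
    (hc : Continuous fun q : EuclideanSpace ℝ (Fin N) × A => c q.1 q.2)
    {β : ℝ → Measure A} (hβ : IsRelaxedControl β) (x z : EuclideanSpace ℝ (Fin N))
    {h ε η M : ℝ} (hh : 0 < h) (hε : 0 < ε) (hη : 0 < η)
    (hM : ∀ s ∈ Icc 0 h, ∀ a, ‖f (Y x β s) a‖ ≤ M)
    (h1 : ‖x - z‖ ^ 2 / (2 * ε) ≤ η)
    (h2 : L * (M * h) * (‖x - z‖ / ε) ≤ η) (h3 : M ^ 2 * h / (2 * ε) ≤ η)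
    (hcc : ∀ y, ‖y - z‖ ≤ M * h + ‖x - z‖ → ∀ a, |c y a - c z a| ≤ η)
    (hvisc : ∀ s ∈ Ioo 0 h, inner (𝕜 := ℝ) (∫ a, f z a ∂(β s)) ((1 / ε) • (x - z)) +
      ∫ a, c z a ∂(β s) ≤ η) :
    ‖Y x β h - z‖ ^ 2 / (2 * ε) + rcost c β (Y x β) h ≤
      ‖x - z‖ ^ 2 / (2 * ε) + h * (η * (4 + 2 * L)) := by
  have hy := S.cty hβ x
  have hL := S.pos
  have hmove : ∀ s ∈ Icc 0 h, ‖Y x β s - x‖ ≤ M * h := by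
    intro s hs
    have e := (S.traj x β hβ).2.2 s hs.1
    have : ‖∫ r in (0:ℝ)..s, ∫ a, f (Y x β r) a ∂(β r)‖ ≤ M * |s - 0| := by
      refine intervalIntegral.norm_integral_le_of_norm_le_const fun r hr => ?_
      rw [uIoc_of_le hs.1] at hr
      have := hβ.1 r
      exact norm_relInt_le (hM r ⟨hr.1.le, hr.2.trans hs.2⟩)
    have e2 : Y x β s - x = ∫ r in (0:ℝ)..s, ∫ a, f (Y x β r) a ∂(β r) := by
      rw [sub_eq_iff_eq_add', ← e]
    rw [e2]
    refine this.trans ?_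
    rw [sub_zero, abs_of_nonneg hs.1]
    have hM0 : 0 ≤ M := by
      have := hβ.1 0
      obtain ⟨a⟩ := (β 0).nonempty_of_neZero
      exact (norm_nonneg _).trans (hM 0 ⟨le_rfl, hh.le⟩ a)
    exact mul_le_mul_of_nonneg_left hs.2 hM0
  set q : EuclideanSpace ℝ (Fin N) := (1 / ε) • (x - z) with hq
  have hqn : ‖q‖ = ‖x - z‖ / ε := by
    rw [hq, norm_smul, Real.norm_of_nonneg (by positivity)]; ring
  have hpt : ∀ s ∈ Ioo 0 h, inner (𝕜 := ℝ) q (∫ a, f (Y x β s) a ∂(β s)) +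
      ∫ a, c (Y x β s) a ∂(β s) ≤ η * (3 + 2 * L) := by
    intro s hs
    have hs' : s ∈ Icc 0 h := ⟨hs.1.le, hs.2.le⟩
    have := hβ.1 s
    have hd : ‖Y x β s - z‖ ≤ M * h + ‖x - z‖ := by
      calc ‖Y x β s - z‖ = ‖(Y x β s - x) + (x - z)‖ := by rw [sub_add_sub_cancel]
        _ ≤ _ := (norm_add_le _ _).trans (by linarith [hmove s hs'])
    have g1 : ∫ a, c (Y x β s) a ∂(β s) ≤ (∫ a, c z a ∂(β s)) + η := by
      have : ‖∫ a, (c (Y x β s) a - c z a) ∂(β s)‖ ≤ η := norm_relInt_le (hcc _ hd)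
      rw [integral_sub (cont_integrable (slice_cont hc _) _)
        (cont_integrable (slice_cont hc _) _), Real.norm_eq_abs, abs_le] at this
      linarith [this.2]
    have g2 : inner (𝕜 := ℝ) q (∫ a, f (Y x β s) a ∂(β s)) ≤
        inner (𝕜 := ℝ) (∫ a, f z a ∂(β s)) q + (η + 2 * L * η) := by
      rw [real_inner_comm q (∫ a, f z a ∂(β s))]
      rw [← sub_le_iff_le_add', ← inner_sub_right]
      refine (real_inner_le_norm _ _).trans ?_
      have := relInt_sub_le S (m := β s) (Y x β s) z
      calc ‖q‖ * ‖(∫ a, f (Y x β s) a ∂(β s)) - ∫ a, f z a ∂(β s)‖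
          ≤ ‖q‖ * (L * (M * h + ‖x - z‖)) := by
            gcongr
            exact this.trans (by gcongr)
        _ = L * (M * h) * (‖x - z‖ / ε) + 2 * L * (‖x - z‖ ^ 2 / (2 * ε)) := by
            rw [hqn]; field_simp
        _ ≤ η + 2 * L * η := by gcongr
    have := hvisc s hs
    linarith
  have hinteg : ∫ s in (0:ℝ)..h, (inner (𝕜 := ℝ) q (∫ a, f (Y x β s) a ∂(β s)) +
      ∫ a, c (Y x β s) a ∂(β s)) = inner (𝕜 := ℝ) q (Y x β h - x) + rcost c β (Y x β) h := by
    have i1 := rel_ii S.cont hβ hy 0 h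
    have i2 := rel_ii hc hβ hy 0 h
    have i3 : IntervalIntegrable (fun s => inner (𝕜 := ℝ) q (∫ a, f (Y x β s) a ∂(β s)))
        volume 0 h := ⟨i1.1.const_inner q, i1.2.const_inner q⟩
    rw [intervalIntegral.integral_add i3 i2]
    congr 1
    have := (innerSL ℝ q).intervalIntegral_comp_comm i1
    simp only [innerSL_apply_apply] at this
    rw [this]
    congr 1
    rw [(S.traj x β hβ).2.2 h hh.le, add_sub_cancel_left]
  have hle : ∫ s in (0:ℝ)..h, (inner (𝕜 := ℝ) q (∫ a, f (Y x β s) a ∂(β s)) +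
      ∫ a, c (Y x β s) a ∂(β s)) ≤ h * (η * (3 + 2 * L)) := by
    have i1 := rel_ii S.cont hβ hy 0 h
    have i2 := rel_ii hc hβ hy 0 h
    have i3 : IntervalIntegrable (fun s => inner (𝕜 := ℝ) q (∫ a, f (Y x β s) a ∂(β s)))
        volume 0 h := ⟨i1.1.const_inner q, i1.2.const_inner q⟩
    have := intervalIntegral.integral_mono_on_of_le_Ioo hh.le (i3.add i2)
      (intervalIntegrable_const (c := η * (3 + 2 * L))) hpt
    rw [intervalIntegral.integral_const, sub_zero, smul_eq_mul] at this
    exact this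
  rw [hinteg] at hle
  have hsq : ‖Y x β h - z‖ ^ 2 / (2 * ε) = ‖x - z‖ ^ 2 / (2 * ε) +
      inner (𝕜 := ℝ) q (Y x β h - x) + ‖Y x β h - x‖ ^ 2 / (2 * ε) := by
    have : Y x β h - z = (x - z) + (Y x β h - x) := by abel
    rw [this, norm_add_sq_real, hq, inner_smul_left]
    simp only [one_div, map_inv₀, conj_trivial]
    field_simp
  have hlast : ‖Y x β h - x‖ ^ 2 / (2 * ε) ≤ h * η := by
    calc ‖Y x β h - x‖ ^ 2 / (2 * ε) ≤ (M * h) ^ 2 / (2 * ε) := by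
          gcongr; exact hmove h ⟨hh.le, le_rfl⟩
      _ = h * (M ^ 2 * h / (2 * ε)) := by ring
      _ ≤ h * η := by gcongr
  rw [hsq]
  linarith
end Core

section Core2
variable {N : ℕ} {A : Type*} [MetricSpace A] [CompactSpace A] [MeasurableSpace A] [BorelSpace A]
  {f : EuclideanSpace ℝ (Fin N) → A → EuclideanSpace ℝ (Fin N)} {L : ℝ}
  {Y : EuclideanSpace ℝ (Fin N) → (ℝ → Measure A) → ℝ → EuclideanSpace ℝ (Fin N)}

lemma core (S : Sys f L Y) {c : EuclideanSpace ℝ (Fin N) → A → ℝ}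
    (hc : Continuous fun q : EuclideanSpace ℝ (Fin N) × A => c q.1 q.2)
    {u : EuclideanSpace ℝ (Fin N) → ℝ} (hu : Continuous u)
    (R d η : ℝ) (hd : 0 < d) (hη : 0 < η) :
    ∃ h0 > 0, ∃ ε > 0, ∃ V : EuclideanSpace ℝ (Fin N) → ℝ,
      (∀ x, ‖x‖ ≤ R → V x ≤ u x ∧ u x ≤ V x + η) ∧
      ∀ x, ‖x‖ ≤ R → ∃ z, ‖x - z‖ < d ∧
        IsLocalMin (fun z' => u z' + ‖x - z'‖ ^ 2 / (2 * ε)) z ∧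
        ∀ h, 0 < h → h ≤ h0 → ∀ β, IsRelaxedControl β → (∀ s ∈ Icc 0 h, ‖Y x β s‖ ≤ R) →
          (∀ s ∈ Ioo 0 h, inner (𝕜 := ℝ) (∫ a, f z a ∂(β s)) ((1 / ε) • (x - z)) +
            ∫ a, c z a ∂(β s) ≤ η) →
          V (Y x β h) + rcost c β (Y x β) h ≤ V x + h * (η * (4 + 2 * L)) := by
  set K : Set (EuclideanSpace ℝ (Fin N)) := closedBall 0 (R + 1) with hKdef
  have hK : IsCompact K := isCompact_closedBall _ _
  have hKm : ∀ x, ‖x‖ ≤ R + 1 → x ∈ K := fun x hx => by simpa [hKdef] using hx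
  obtain ⟨W, hW⟩ := hK.exists_bound_of_continuousOn hu.continuousOn
  obtain ⟨M, hM0, hM⟩ := exists_bound_compact hK (g := f) S.cont
  have huu := hK.uniformContinuousOn_of_continuous hu.continuousOn
  have hcu := (hK.prod (isCompact_univ (X := A))).uniformContinuousOn_of_continuous hc.continuousOn
  obtain ⟨r1, hr1, hr1'⟩ := Metric.uniformContinuousOn_iff.1 huu η hη
  obtain ⟨r2, hr2, hr2'⟩ := Metric.uniformContinuousOn_iff.1 hcu η hη
  obtain ⟨r, hr, e1, e2, e3, e4⟩ : ∃ r > 0, r < r1 ∧ 2 * r < r2 ∧ r < d ∧ 3 * r < 1 := by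
    refine ⟨min (min r1 r2) (min d 1) / 4, by positivity, ?_, ?_, ?_, ?_⟩
    · have : min (min r1 r2) (min d 1) ≤ r1 := (min_le_left _ _).trans (min_le_left _ _)
      linarith
    · have : min (min r1 r2) (min d 1) ≤ r2 := (min_le_left _ _).trans (min_le_right _ _)
      linarith
    · have : min (min r1 r2) (min d 1) ≤ d := (min_le_right _ _).trans (min_le_left _ _)
      linarith
    · have : min (min r1 r2) (min d 1) ≤ 1 := (min_le_right _ _).trans (min_le_right _ _)
      linarith
  set ε : ℝ := r ^ 2 / (4 * (|W| + 1)) with hεdef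
  have hε : 0 < ε := by positivity
  obtain ⟨h0, hh0, hh0'⟩ : ∃ h0 > 0, ∀ h, 0 < h → h ≤ h0 →
      M * h ≤ r ∧ L * (M * h) * (r / ε) ≤ η ∧ M ^ 2 * h / (2 * ε) ≤ η := by
    have t1 : Tendsto (fun h : ℝ => M * h) (𝓝 0) (𝓝 0) :=
      Continuous.tendsto' (by fun_prop) _ _ (by simp)
    have t2 : Tendsto (fun h : ℝ => L * (M * h) * (r / ε)) (𝓝 0) (𝓝 0) :=
      Continuous.tendsto' (by fun_prop) _ _ (by simp)
    have t3 : Tendsto (fun h : ℝ => M ^ 2 * h / (2 * ε)) (𝓝 0) (𝓝 0) :=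
      Continuous.tendsto' (by fun_prop) _ _ (by simp)
    have := (t1.eventually_lt_const hr).and
      ((t2.eventually_lt_const hη).and (t3.eventually_lt_const hη))
    obtain ⟨δ, hδ, hδ'⟩ := Metric.eventually_nhds_iff.1 this
    refine ⟨δ / 2, by positivity, fun h hh hh2 => ?_⟩
    have := @hδ' h (by rw [Real.dist_eq, sub_zero, abs_of_pos hh]; linarith)
    exact ⟨this.1.le, this.2.1.le, this.2.2.le⟩
  set V : EuclideanSpace ℝ (Fin N) → ℝ :=
    fun x => sInf ((fun z => u z + ‖x - z‖ ^ 2 / (2 * ε)) '' K) with hV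
  have hcont : ∀ x, Continuous fun z => u z + ‖x - z‖ ^ 2 / (2 * ε) := fun x => by fun_prop
  have hVle : ∀ x, ∀ z ∈ K, V x ≤ u z + ‖x - z‖ ^ 2 / (2 * ε) := fun x z hz =>
    csInf_le (hK.image (hcont x)).bddBelow (mem_image_of_mem _ hz)
  have hmin : ∀ x, ‖x‖ ≤ R → ∃ z ∈ K, V x = u z + ‖x - z‖ ^ 2 / (2 * ε) ∧ ‖x - z‖ ≤ r ∧
      ‖x - z‖ ^ 2 / (2 * ε) ≤ η ∧ IsMinOn (fun z => u z + ‖x - z‖ ^ 2 / (2 * ε)) K z ∧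
      |u x - u z| < η := by
    intro x hx
    have hxK : x ∈ K := hKm x (by linarith)
    obtain ⟨z, hz, hzmin⟩ := hK.exists_isMinOn ⟨x, hxK⟩ (hcont x).continuousOn
    have e : V x = u z + ‖x - z‖ ^ 2 / (2 * ε) :=
      IsLeast.csInf_eq ⟨mem_image_of_mem _ hz, by rintro _ ⟨z', hz', rfl⟩; exact hzmin hz'⟩
    have l1 : ‖x - z‖ ^ 2 / (2 * ε) ≤ u x - u z := by
      have := hVle x x hxK
      rw [e] at this
      simp at this
      linarith
    have b1 := hW x hxK
    have b2 := hW z hz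
    rw [Real.norm_eq_abs, abs_le] at b1 b2
    have l2 : ‖x - z‖ ^ 2 / (2 * ε) ≤ 2 * |W| := by
      have := le_abs_self W
      linarith [b1.2, b2.1]
    have l3 : ‖x - z‖ ≤ r := by
      rw [div_le_iff₀ (by positivity)] at l2
      have : ε * (4 * (|W| + 1)) = r ^ 2 := by rw [hεdef]; field_simp
      have h4 : ‖x - z‖ ^ 2 ≤ r ^ 2 := by
        nlinarith [abs_nonneg W]
      exact (sq_le_sq₀ (norm_nonneg _) hr.le).1 h4
    have l4 := hr1' x hxK z hz (by rw [dist_eq_norm]; linarith)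
    rw [Real.dist_eq] at l4
    exact ⟨z, hz, e, l3, by linarith [le_abs_self (u x - u z)], hzmin, l4⟩
  refine ⟨h0, hh0, ε, hε, V, ?_, ?_⟩
  · intro x hx
    have hxK : x ∈ K := hKm x (by linarith)
    constructor
    · simpa using hVle x x hxK
    · obtain ⟨z, hz, e, l3, l5, hzmin, l4⟩ := hmin x hx
      rw [e]
      have : 0 ≤ ‖x - z‖ ^ 2 / (2 * ε) := by positivity
      linarith [le_abs_self (u x - u z)]
  · intro x hx
    obtain ⟨z, hz, e, l3, l5, hzmin, l4⟩ := hmin x hx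
    have hznorm : ‖z‖ ≤ R + r := by
      calc ‖z‖ = ‖x - (x - z)‖ := by rw [sub_sub_cancel]
        _ ≤ _ := (norm_sub_le _ _).trans (by linarith)
    refine ⟨z, by linarith, ?_, ?_⟩
    · refine hzmin.isLocalMin ?_
      refine Filter.mem_of_superset (isOpen_ball.mem_nhds (x := z)
        (s := ball 0 (R + 1)) ?_) ball_subset_closedBall
      simp only [mem_ball, dist_zero_right]
      linarith
    · intro h hh hh1 β hβ hball hvisc
      obtain ⟨g1, g2, g3⟩ := hh0' h hh hh1
      have := step_est S hc hβ x z hh hε hη (M := M)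
        (fun s hs a => hM _ (hKm _ (by linarith [hball s hs])) a) l5
        ?_ g3 ?_ hvisc
      · have h2 := hVle (Y x β h) z hz
        rw [e]
        linarith
      · refine le_trans ?_ g2
        have := S.pos
        gcongr
      · intro y hy a
        have hyK : y ∈ K := by
          apply hKm
          calc ‖y‖ = ‖(y - z) + z‖ := by rw [sub_add_cancel]
            _ ≤ _ := (norm_add_le _ _)
            _ ≤ R + 1 := ?_
          -- crude bound
          have : ‖y - z‖ ≤ 2 * r := by linarith
          have h5 : ‖z‖ ≤ R + r := hznorm
          linarith
        have := hr2' (y, a) ⟨hyK, mem_univ _⟩ (z, a) ⟨hz, mem_univ _⟩ (by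
          rw [Prod.dist_eq, dist_self, max_eq_left dist_nonneg, dist_eq_norm]; linarith)
        rw [Real.dist_eq] at this
        exact this.le
end Core2

section Visc
variable {N : ℕ} {A : Type*} [MetricSpace A] [CompactSpace A] [MeasurableSpace A] [BorelSpace A]
  {f : EuclideanSpace ℝ (Fin N) → A → EuclideanSpace ℝ (Fin N)} {L : ℝ}
  {Y : EuclideanSpace ℝ (Fin N) → (ℝ → Measure A) → ℝ → EuclideanSpace ℝ (Fin N)}

lemma grad_quad (x z : EuclideanSpace ℝ (Fin N)) (k : ℝ) :
    gradient (fun z' => k * ‖x - z'‖ ^ 2) z = (-2 * k) • (x - z) := by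
  apply HasGradientAt.gradient
  rw [hasGradientAt_iff_hasFDerivAt]
  have h1 : HasFDerivAt (fun z' : EuclideanSpace ℝ (Fin N) => x - z')
      (-ContinuousLinearMap.id ℝ _) z := by
    exact (hasFDerivAt_id z).const_sub x
  have h2 := (h1.norm_sq).const_mul k
  refine h2.congr_fderiv (ContinuousLinearMap.ext fun v => ?_)
  simp [inner_smul_left]
  ring

lemma smooth_quad (x : EuclideanSpace ℝ (Fin N)) (k : ℝ) (s : Set (EuclideanSpace ℝ (Fin N))) :
    ContDiffOn ℝ 1 (fun z' => k * ‖x - z'‖ ^ 2) s := by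
  apply ContDiff.contDiffOn
  exact contDiff_const.mul ((contDiff_const.sub contDiff_id).norm_sq ℝ)

lemma HJB_bdd (S : Sys f L Y) {ℓ : EuclideanSpace ℝ (Fin N) → A → ℝ}
    (hnn : ∀ x a, 0 ≤ ℓ x a) (x p : EuclideanSpace ℝ (Fin N)) :
    BddAbove (range fun m : ProbabilityMeasure A =>
    (-(inner (𝕜 := ℝ) (∫ a, f x a ∂(m : Measure A)) p : ℝ) - ∫ a, ℓ x a ∂(m : Measure A))) := by
  obtain ⟨C, hC0, hC⟩ := exists_bound_compact (isCompact_singleton (x := x)) (g := f) S.cont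
  refine ⟨C * ‖p‖, ?_⟩
  rintro _ ⟨m, rfl⟩
  have h1 : ‖∫ a, f x a ∂(m : Measure A)‖ ≤ C := norm_relInt_le (hC x rfl)
  have h2 := relInt_nonneg hnn x (m : Measure A)
  have h3 := abs_real_inner_le_norm (∫ a, f x a ∂(m : Measure A)) p
  have h4 := neg_abs_le (inner (𝕜 := ℝ) (∫ a, f x a ∂(m : Measure A)) p)
  have h5 : ‖∫ a, f x a ∂(m : Measure A)‖ * ‖p‖ ≤ C * ‖p‖ := by gcongr
  dsimp only
  linarith

lemma visc_super (S : Sys f L Y) [Nonempty A] {ℓ : EuclideanSpace ℝ (Fin N) → A → ℝ}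
    {T : Set (EuclideanSpace ℝ (Fin N))} {w : EuclideanSpace ℝ (Fin N) → ℝ}
    (hsol : IsViscositySol (HJB f ℓ) Tᶜ w) {x z : EuclideanSpace ℝ (Fin N)} (hz : z ∉ T)
    {ε : ℝ} (hε : 0 < ε) (hmin : IsLocalMin (fun z' => w z' + ‖x - z'‖ ^ 2 / (2 * ε)) z)
    {η : ℝ} (hη : 0 < η) :
    ∃ m : ProbabilityMeasure A, inner (𝕜 := ℝ) (∫ a, f z a ∂(m : Measure A)) ((1 / ε) • (x - z)) +
      ∫ a, ℓ z a ∂(m : Measure A) ≤ η := by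
  have h := hsol.1 (fun z' => (-(1 / (2 * ε))) * ‖x - z'‖ ^ 2) (smooth_quad x _ _) z hz ?_
  · rw [grad_quad] at h
    have e : (-2 * -(1 / (2 * ε))) = 1 / ε := by field_simp
    rw [e] at h
    have := (inferInstance : Nonempty A)
    obtain ⟨a0⟩ := this
    have : Nonempty (ProbabilityMeasure A) := ⟨⟨Measure.dirac a0, inferInstance⟩⟩
    unfold HJB at h
    obtain ⟨m, hm⟩ := exists_lt_of_lt_ciSup (lt_of_lt_of_le (neg_lt_zero.2 hη) h)
    exact ⟨m, by linarith⟩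
  · have : (fun z' => w z' - (-(1 / (2 * ε))) * ‖x - z'‖ ^ 2) =
        fun z' => w z' + ‖x - z'‖ ^ 2 / (2 * ε) := by
      ext z'; ring
    rw [this]
    exact hmin.on _

lemma visc_sub (S : Sys f L Y) {ℓ : EuclideanSpace ℝ (Fin N) → A → ℝ}
    (hnn : ∀ x a, 0 ≤ ℓ x a)
    {T : Set (EuclideanSpace ℝ (Fin N))} {w : EuclideanSpace ℝ (Fin N) → ℝ}
    (hsol : IsViscositySol (HJB f ℓ) Tᶜ w) {x z : EuclideanSpace ℝ (Fin N)} (hz : z ∉ T)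
    {ε : ℝ} (hε : 0 < ε) (hmin : IsLocalMin (fun z' => -w z' + ‖x - z'‖ ^ 2 / (2 * ε)) z)
    (m : Measure A) [hm : IsProbabilityMeasure m] :
    inner (𝕜 := ℝ) (∫ a, f z a ∂m) ((1 / ε) • (x - z)) + ∫ a, -ℓ z a ∂m ≤ 0 := by
  have h := hsol.2 (fun z' => (1 / (2 * ε)) * ‖x - z'‖ ^ 2) (smooth_quad x _ _) z hz ?_
  · rw [grad_quad] at h
    have e : (-2 * (1 / (2 * ε))) = -(1 / ε) := by field_simp
    rw [e, neg_smul] at h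
    have := (le_ciSup (HJB_bdd S hnn z (-((1 / ε) • (x - z)))) ⟨m, hm⟩).trans h
    simp only [ProbabilityMeasure.coe_mk, inner_neg_right, neg_neg] at this
    rw [integral_neg]
    linarith
  · have : (fun z' => w z' - (1 / (2 * ε)) * ‖x - z'‖ ^ 2) =
        fun z' => -(-w z' + ‖x - z'‖ ^ 2 / (2 * ε)) := by
      ext z'; ring
    rw [this]
    exact (hmin.neg).on _

lemma rcost_neg (ℓ : EuclideanSpace ℝ (Fin N) → A → ℝ) (β : ℝ → Measure A)
    (y : ℝ → EuclideanSpace ℝ (Fin N)) (t : ℝ) :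
    rcost (fun x a => -ℓ x a) β y t = -rcost ℓ β y t := by
  unfold rcost
  simp only [integral_neg, intervalIntegral.integral_neg]

lemma dist_compact_closed {K T : Set (EuclideanSpace ℝ (Fin N))} (hK : IsCompact K)
    (hT : IsClosed T) (hd : Disjoint K T) :
    ∃ d > 0, ∀ y ∈ K, ∀ z, ‖y - z‖ < d → z ∉ T := by
  obtain ⟨d, hd0, hd'⟩ := hd.exists_thickenings hK hT
  refine ⟨d, hd0, fun y hy z hz hzT => ?_⟩
  refine Set.disjoint_left.1 hd' (?_ : z ∈ _) (self_subset_thickening hd0 _ hzT)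
  rw [mem_thickening_iff]
  exact ⟨y, hy, by rw [dist_comm, dist_eq_norm]; exact hz⟩

/-- Suboptimality principle. -/
lemma subopt (S : Sys f L Y) {ℓ : EuclideanSpace ℝ (Fin N) → A → ℝ}
    (hℓ : Continuous fun q : EuclideanSpace ℝ (Fin N) × A => ℓ q.1 q.2)
    (hnn : ∀ x a, 0 ≤ ℓ x a)
    {T : Set (EuclideanSpace ℝ (Fin N))} (hT : IsClosed T)
    {w : EuclideanSpace ℝ (Fin N) → ℝ} (hw : Continuous w)
    (hsol : IsViscositySol (HJB f ℓ) Tᶜ w)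
    {β : ℝ → Measure A} (hβ : IsRelaxedControl β) (x : EuclideanSpace ℝ (Fin N))
    {t : ℝ} (ht : 0 < t) (hout : ∀ s ∈ Icc 0 t, Y x β s ∉ T) :
    w x ≤ rcost ℓ β (Y x β) t + w (Y x β t) := by
  have hy := S.cty hβ x
  have hL := S.pos
  have hKc : IsCompact (Y x β '' Icc 0 t) := isCompact_Icc.image hy
  obtain ⟨d, hd, hd'⟩ := dist_compact_closed hKc hT (by
    rw [Set.disjoint_left]; rintro _ ⟨s, hs, rfl⟩; exact hout s hs)
  obtain ⟨R, hR⟩ := hKc.isBounded.exists_norm_le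
  refine le_of_forall_pos_le_add fun e he => ?_
  set η : ℝ := e / (1 + t * (4 + 2 * L)) with hη
  have hη0 : 0 < η := by positivity
  have hηe : η * (1 + t * (4 + 2 * L)) = e := by rw [hη]; field_simp
  have hc : Continuous fun q : EuclideanSpace ℝ (Fin N) × A =>
    (fun x a => -ℓ x a) q.1 q.2 := hℓ.neg
  obtain ⟨h0, hh0, ε, hε, V, hV, hstep⟩ := core S (c := fun x a => -ℓ x a) hc (u := fun x => -w x) hw.neg R d η hd hη0
  obtain ⟨n, hn⟩ := exists_nat_gt (t / h0)
  have hn0 : (0:ℝ) < n := lt_of_le_of_lt (by positivity) hn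
  set h : ℝ := t / n with hh
  have hhp : 0 < h := by positivity
  have hhle : h ≤ h0 := by
    rw [hh, div_le_iff₀ hn0]
    rw [div_lt_iff₀ hh0] at hn
    linarith
  have hnh : n * h = t := by rw [hh]; field_simp
  have hmem : ∀ s ∈ Icc 0 t, Y x β s ∈ Y x β '' Icc 0 t := fun s hs => mem_image_of_mem _ hs
  have ind : ∀ k : ℕ, k ≤ n → V (Y x β (k * h)) + rcost (fun x a => -ℓ x a) β (Y x β) (k * h) ≤
      V x + k * h * (η * (4 + 2 * L)) := by
    intro k
    induction k with
    | zero => intro _; simp [S.zero hβ, rcost]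
    | succ k ih =>
      intro hk
      have ihk := ih (by omega)
      have hkp : (0:ℝ) ≤ k * h := by positivity
      have hkt : k * h + h ≤ t := by
        have : ((k:ℝ) + 1) ≤ n := by exact_mod_cast hk
        nlinarith
      have hkI : (k * h : ℝ) ∈ Icc 0 t := ⟨hkp, by linarith⟩
      obtain ⟨z, hz, hzmin, hzs⟩ := hstep (Y x β (k * h)) (hR _ (hmem _ hkI))
      have hzT := hd' _ (hmem _ hkI) z hz
      have hsr := relaxed_shift hβ (k * h)
      have := hzs h hhp hhle _ hsr ?_ ?_
      · rw [← S.shift hβ x hkp hhp.le] at this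
        have e2 := rcost_shift S (c := fun x a => -ℓ x a) hc hβ x hkp hhp.le
        have e3 : ((k + 1 : ℕ) : ℝ) * h = k * h + h := by push_cast; ring
        rw [e3, e2]
        linarith
      · intro s hs
        rw [← S.shift hβ x hkp hs.1]
        exact hR _ (hmem _ ⟨by linarith [hs.1], by linarith [hs.2]⟩)
      · intro s hs
        have := hsr.1 s
        exact (visc_sub S hnn hsol hzT hε hzmin _).trans hη0.le
  have fin := ind n le_rfl
  rw [hnh, rcost_neg] at fin
  have v1 := (hV x (hR x ⟨0, ⟨le_rfl, ht.le⟩, S.zero hβ x⟩)).1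
  have v2 := (hV _ (hR _ (hmem t ⟨ht.le, le_rfl⟩))).2
  have : η * (1 + t * (4 + 2 * L)) = η + t * (η * (4 + 2 * L)) := by ring
  linarith
end Visc

section Super
variable {N : ℕ} {A : Type*} [MetricSpace A] [CompactSpace A] [MeasurableSpace A] [BorelSpace A]
  {f : EuclideanSpace ℝ (Fin N) → A → EuclideanSpace ℝ (Fin N)} {L : ℝ}
  {Y : EuclideanSpace ℝ (Fin N) → (ℝ → Measure A) → ℝ → EuclideanSpace ℝ (Fin N)}

lemma const_relaxed (m : ProbabilityMeasure A) :
    IsRelaxedControl (fun _ : ℝ => (m : Measure A)) :=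
  ⟨fun _ => inferInstance, fun _ => measurable_const⟩

/-- Approximate superoptimality principle on a unit time interval. -/
lemma supopt (S : Sys f L Y) [Nonempty A] {ℓ : EuclideanSpace ℝ (Fin N) → A → ℝ}
    (hℓ : Continuous fun q : EuclideanSpace ℝ (Fin N) × A => ℓ q.1 q.2)
    {T : Set (EuclideanSpace ℝ (Fin N))} (hT : IsClosed T)
    {w : EuclideanSpace ℝ (Fin N) → ℝ} (hw : Continuous w)
    (hsol : IsViscositySol (HJB f ℓ) Tᶜ w)
    {U : Set (EuclideanSpace ℝ (Fin N))} (hU : IsOpen U) (hTU : T ⊆ U)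
    {e : ℝ} (he : 0 < e) (x : EuclideanSpace ℝ (Fin N)) :
    ∃ β, IsRelaxedControl β ∧ ∃ t ∈ Icc (0:ℝ) 1, (t = 1 ∨ Y x β t ∈ U) ∧
      w (Y x β t) + rcost ℓ β (Y x β) t ≤ w x + e := by
  have hL := S.pos
  obtain ⟨R, hR⟩ := S.growth ‖x‖ 1 zero_le_one
  have hKc : IsCompact (closedBall (0 : EuclideanSpace ℝ (Fin N)) R \ U) :=
    (isCompact_closedBall _ _).diff hU
  obtain ⟨d, hd, hd'⟩ := dist_compact_closed hKc hT (by
    rw [Set.disjoint_left]; intro y hy hyT; exact hy.2 (hTU hyT))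
  set η : ℝ := e / (1 + (4 + 2 * L)) with hη
  have hη0 : 0 < η := by positivity
  have hηe : η * (1 + (4 + 2 * L)) = e := by rw [hη]; field_simp
  obtain ⟨h0, hh0, ε, hε, V, hV, hstep⟩ := core S hℓ hw R d η hd hη0
  obtain ⟨n, hn⟩ := exists_nat_gt (1 / h0)
  have hn0 : (0:ℝ) < n := lt_of_le_of_lt (by positivity) hn
  set h : ℝ := 1 / n with hh
  have hhp : 0 < h := by positivity
  have hhle : h ≤ h0 := by
    rw [hh, div_le_iff₀ hn0]
    rw [div_lt_iff₀ hh0] at hn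
    linarith
  have hnh : n * h = 1 := by rw [hh]; field_simp
  have hch : ∀ x', ∃ m : ProbabilityMeasure A, ‖x'‖ ≤ R → x' ∉ U →
      (∀ s ∈ Icc 0 h, ‖Y x' (fun _ => (m : Measure A)) s‖ ≤ R) →
      V (Y x' (fun _ => (m : Measure A)) h) +
        rcost ℓ (fun _ => (m : Measure A)) (Y x' (fun _ => (m : Measure A))) h ≤
        V x' + h * (η * (4 + 2 * L)) := by
    intro x'
    by_cases hx' : ‖x'‖ ≤ R ∧ x' ∉ U
    · obtain ⟨z, hz, hzmin, hzs⟩ := hstep x' hx'.1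
      have hzT := hd' x' ⟨by simpa using hx'.1, hx'.2⟩ z hz
      obtain ⟨m, hm⟩ := visc_super S hsol hzT hε hzmin hη0
      exact ⟨m, fun _ _ hb => hzs h hhp hhle _ (const_relaxed m) hb fun s _ => hm⟩
    · obtain ⟨a0⟩ := (inferInstance : Nonempty A)
      exact ⟨⟨Measure.dirac a0, inferInstance⟩, fun h1 h2 => (hx' ⟨h1, h2⟩).elim⟩
  choose m hm using hch
  set xs : ℕ → EuclideanSpace ℝ (Fin N) := fun k =>
    Nat.rec x (fun _ x' => Y x' (fun _ => (m x' : Measure A)) h) k with hxs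
  have hxs0 : xs 0 = x := rfl
  have hxsS : ∀ k, xs (k + 1) = Y (xs k) (fun _ => (m (xs k) : Measure A)) h := fun k => rfl
  have hβr : ∀ k, IsRelaxedControl ((fun k _ => (m (xs k) : Measure A)) k : ℝ → Measure A) :=
    fun k => const_relaxed _
  have tr := icat_traj S hhp (β := fun k _ => (m (xs k) : Measure A)) hβr hℓ hxsS
  set B : ℝ → Measure A := icat h (fun k _ => (m (xs k) : Measure A)) with hB
  have hBr : IsRelaxedControl B := icat_relaxed h hβr
  rw [hxs0] at tr
  have ind : ∀ k : ℕ, k ≤ n → (∀ j < k, xs j ∉ U) →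
      V (xs k) + rcost ℓ B (Y x B) (k * h) ≤ V x + k * h * (η * (4 + 2 * L)) := by
    intro k
    induction k with
    | zero => intro _ _; simp [hxs0, rcost]
    | succ k ih =>
      intro hk hj
      have ihk := ih (by omega) (fun j hjk => hj j (by omega))
      have hkp : (0:ℝ) ≤ k * h := by positivity
      have hkt : k * h + h ≤ 1 := by
        have : ((k:ℝ) + 1) ≤ n := by exact_mod_cast hk
        nlinarith
      obtain ⟨t1, t2⟩ := tr k
      have := hm (xs k) ?_ (hj k (by omega)) ?_
      · have e3 : ((k + 1 : ℕ) : ℝ) * h = k * h + h := by push_cast; ring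
        rw [e3, (t2 h ⟨hhp.le, le_rfl⟩).2, hxsS]
        linarith
      · rw [← t1]
        exact hR x le_rfl B hBr _ ⟨hkp, by linarith⟩
      · intro s hs
        rw [← (t2 s hs).1]
        exact hR x le_rfl B hBr _ ⟨by linarith [hs.1], by linarith [hs.2]⟩
  obtain ⟨k, hkn, hk1, hk2⟩ : ∃ k ≤ n, (k = n ∨ xs k ∈ U) ∧ ∀ j < k, xs j ∉ U := by
    classical
    by_cases hex : ∃ k, k ≤ n ∧ xs k ∈ U
    · refine ⟨Nat.find hex, (Nat.find_spec hex).1, Or.inr (Nat.find_spec hex).2, ?_⟩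
      intro j hj hjU
      exact Nat.find_min hex hj ⟨hj.le.trans (Nat.find_spec hex).1, hjU⟩
    · exact ⟨n, le_rfl, Or.inl rfl, fun j hj hjU => hex ⟨j, hj.le, hjU⟩⟩
  have hkle : (k:ℝ) * h ≤ 1 := by
    rw [← hnh]
    have : (k:ℝ) ≤ n := by exact_mod_cast hkn
    gcongr
  have hkp : (0:ℝ) ≤ k * h := by positivity
  refine ⟨B, hBr, k * h, ⟨hkp, hkle⟩, ?_, ?_⟩
  · rcases hk1 with hk1 | hk1
    · left; rw [hk1, hnh]
    · right; rw [(tr k).1]; exact hk1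
  · have fin := ind k hkn hk2
    have v1 := (hV x (by
      have := hR x le_rfl B hBr 0 ⟨le_rfl, zero_le_one⟩
      rwa [S.zero hBr] at this)).1
    have v2 := (hV (xs k) (by rw [← (tr k).1]; exact hR x le_rfl B hBr _ ⟨hkp, hkle⟩)).2
    rw [(tr k).1]
    have : k * h * (η * (4 + 2 * L)) ≤ 1 * (η * (4 + 2 * L)) := by gcongr
    have : η * (1 + (4 + 2 * L)) = η + 1 * (η * (4 + 2 * L)) := by ring
    linarith
end Super

section Compactness
variable {A : Type*} [MetricSpace A] [CompactSpace A] [MeasurableSpace A] [BorelSpace A]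

lemma int_unit (h : ℝ → ℝ) : ∫ s in (0:ℝ)..1, h s = ∫ s : unitInterval, h s := by
  rw [intervalIntegral.integral_of_le zero_le_one, ← integral_Icc_eq_integral_Ioc,
    ← integral_subtype_comap measurableSet_Icc]
  rfl

/-- The measure on `[0,1] × A` attached to a relaxed control. -/
def youngMeas (β : ℝ → Measure A) (hβ : IsRelaxedControl β) :
    Measure (unitInterval × A) :=
  Measure.compProd (volume : Measure unitInterval)
    ((relKernel β hβ).comap (Subtype.val : unitInterval → ℝ) measurable_subtype_coe)

lemma young_markov (β : ℝ → Measure A) (hβ : IsRelaxedControl β) :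
    ProbabilityTheory.IsMarkovKernel
      ((relKernel β hβ).comap (Subtype.val : unitInterval → ℝ) measurable_subtype_coe) := by
  haveI := relKernel_markov β hβ
  infer_instance

lemma young_prob (β : ℝ → Measure A) (hβ : IsRelaxedControl β) :
    IsProbabilityMeasure (youngMeas β hβ) := by
  haveI := young_markov β hβ
  unfold youngMeas; infer_instance

lemma young_fst (β : ℝ → Measure A) (hβ : IsRelaxedControl β) :
    (youngMeas β hβ).fst = volume := by
  haveI := young_markov β hβ
  exact Measure.fst_compProd _ _

lemma young_int (β : ℝ → Measure A) (hβ : IsRelaxedControl β) {g : ℝ → A → ℝ}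
    (hg : Continuous (Function.uncurry g)) :
    ∫ s in (0:ℝ)..1, ∫ a, g s a ∂(β s) = ∫ p, g p.1 p.2 ∂(youngMeas β hβ) := by
  haveI := young_markov β hβ
  haveI := young_prob β hβ
  rw [int_unit]
  unfold youngMeas
  rw [Measure.integral_compProd]
  · rfl
  · have hc : Continuous fun p : unitInterval × A => g p.1 p.2 :=
      hg.comp ((continuous_subtype_val.comp continuous_fst).prodMk continuous_snd)
    exact cont_integrable hc (youngMeas β hβ)

lemma weak_lim (β : ℕ → ℝ → Measure A) (hβ : ∀ n, IsRelaxedControl (β n)) :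
    ∃ β' : ℝ → Measure A, IsRelaxedControl β' ∧ ∃ φ : ℕ → ℕ, StrictMono φ ∧
      ∀ g : ℝ → A → ℝ, Continuous (Function.uncurry g) →
        Tendsto (fun n => ∫ s in (0:ℝ)..1, ∫ a, g s a ∂(β (φ n) s)) atTop
          (𝓝 (∫ s in (0:ℝ)..1, ∫ a, g s a ∂(β' s))) := by
  let μ : ℕ → ProbabilityMeasure (unitInterval × A) := fun n => ⟨youngMeas (β n) (hβ n), young_prob _ _⟩
  obtain ⟨ρ, φ, hφ, hlim⟩ := CompactSpace.tendsto_subseq μ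
  have hfst : (ρ : Measure (unitInterval × A)).fst = volume := by
    have h1 : Tendsto (fun n => (μ (φ n)).map (f := Prod.fst) measurable_fst.aemeasurable) atTop
        (𝓝 (ρ.map (f := Prod.fst) measurable_fst.aemeasurable)) :=
      ((ProbabilityMeasure.continuous_map continuous_fst).tendsto ρ).comp hlim
    have h2 : ∀ n, (μ (φ n)).map (f := Prod.fst) measurable_fst.aemeasurable
        = ⟨(volume : Measure unitInterval), inferInstance⟩ := by
      intro n
      apply Subtype.ext
      exact young_fst _ _
    simp only [h2] at h1
    have h3 := tendsto_nhds_unique h1 tendsto_const_nhds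
    exact congrArg (fun m : ProbabilityMeasure unitInterval => (m : Measure unitInterval)) h3
  haveI : Nonempty A := by
    haveI := (hβ 0).1 0
    exact nonempty_of_isProbabilityMeasure (β 0 0)
  let κ := (ρ : Measure (unitInterval × A)).condKernel
  let β' : ℝ → Measure A := fun s => κ (projIcc 0 1 zero_le_one s)
  have hβ' : IsRelaxedControl β' := by
    refine ⟨fun t => inferInstanceAs (IsProbabilityMeasure (κ _)), fun g => ?_⟩
    have h1 : StronglyMeasurable fun s : unitInterval => ∫ a, g a ∂(κ s) :=
      (StronglyMeasurable.integral_kernel_prod_right (κ := κ) (f := fun _ a => g a)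
        (g.continuous.measurable.comp measurable_snd).stronglyMeasurable)
    exact h1.measurable.comp continuous_projIcc.measurable
  refine ⟨β', hβ', φ, hφ, fun g hg => ?_⟩
  have e : youngMeas β' hβ' = (ρ : Measure (unitInterval × A)) := by
    have h := (ρ : Measure (unitInterval × A)).disintegrate (ρ : Measure (unitInterval × A)).condKernel
    rw [hfst] at h
    rw [← h]
    unfold youngMeas
    congr 1
    refine ProbabilityTheory.Kernel.ext fun s => ?_
    show κ (projIcc 0 1 zero_le_one (s:ℝ)) = κ s
    rw [projIcc_val]
  have hc : Continuous fun p : unitInterval × A => g p.1 p.2 :=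
      hg.comp ((continuous_subtype_val.comp continuous_fst).prodMk continuous_snd)
  have h := (ProbabilityMeasure.tendsto_iff_forall_integral_tendsto.1 hlim)
    (BoundedContinuousFunction.mkOfCompact ⟨_, hc⟩)
  rw [young_int β' hβ' hg, e]
  simp only [fun n => young_int (β (φ n)) (hβ (φ n)) hg]
  exact h

end Compactness

/-- Weak convergence of relaxed controls on `[0,1]`. -/
def WConv {A : Type*} [MetricSpace A] [MeasurableSpace A]
    (β : ℕ → ℝ → Measure A) (β' : ℝ → Measure A) : Prop :=
  ∀ g : ℝ → A → ℝ, Continuous (Function.uncurry g) →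
        Tendsto (fun n => ∫ s in (0:ℝ)..1, ∫ a, g s a ∂(β n s)) atTop
          (𝓝 (∫ s in (0:ℝ)..1, ∫ a, g s a ∂(β' s)))

section ClosedCost
variable {N : ℕ} {A : Type*} [MetricSpace A] [CompactSpace A] [MeasurableSpace A] [BorelSpace A]
  {f : EuclideanSpace ℝ (Fin N) → A → EuclideanSpace ℝ (Fin N)} {L : ℝ}
  {Y : EuclideanSpace ℝ (Fin N) → (ℝ → Measure A) → ℝ → EuclideanSpace ℝ (Fin N)}

lemma cut_est {β : ℝ → Measure A} (hβ : IsRelaxedControl β) {g : ℝ → A → ℝ}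
    (hg : Continuous (Function.uncurry g)) {C : ℝ} (hC : ∀ s ∈ Icc (0:ℝ) 1, ∀ a, ‖g s a‖ ≤ C)
    {t : ℝ} (ht : t ∈ Icc (0:ℝ) 1) {δ : ℝ} (hδ : 0 < δ) :
    ‖(∫ s in (0:ℝ)..1, ∫ a, (max 0 (min 1 ((t - s) / δ + 1))) * g s a ∂(β s)) -
      ∫ s in (0:ℝ)..t, ∫ a, g s a ∂(β s)‖ ≤ C * δ := by
  set χ : ℝ → ℝ := fun s => max 0 (min 1 ((t - s) / δ + 1)) with hχ
  have hχc : Continuous χ := by fun_prop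
  have hgc : Continuous (Function.uncurry fun s a => χ s * g s a) :=
    (hχc.comp continuous_fst).mul hg
  have ii := fun a b => relInt_intervalIntegrable hβ hgc a b
  have hC0 : 0 ≤ C := by
    haveI := hβ.1 0
    obtain ⟨a⟩ := nonempty_of_isProbabilityMeasure (β 0)
    exact (norm_nonneg _).trans (hC 0 ⟨le_rfl, zero_le_one⟩ a)
  set m := min 1 (t + δ) with hm
  have htm : t ≤ m := le_min ht.2 (by linarith)
  have hm1 : m ≤ 1 := min_le_left _ _
  have e1 : ∫ s in (0:ℝ)..t, ∫ a, χ s * g s a ∂(β s) = ∫ s in (0:ℝ)..t, ∫ a, g s a ∂(β s) := by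
    apply intervalIntegral.integral_congr
    intro s hs
    rw [uIcc_of_le ht.1] at hs
    have : χ s = 1 := by
      have : 0 ≤ (t - s) / δ := div_nonneg (by linarith [hs.2]) hδ.le
      simp only [hχ]
      rw [min_eq_left (by linarith)]; simp
    simp only [this, one_mul]
  have e2 : ∫ s in m..1, ∫ a, χ s * g s a ∂(β s) = 0 := by
    rcases le_total 1 (t + δ) with h | h
    · rw [hm, min_eq_left h, intervalIntegral.integral_same]
    rw [← intervalIntegral.integral_zero (a := m) (b := 1) (μ := volume)]
    apply intervalIntegral.integral_congr
    intro s hs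
    rw [uIcc_of_le hm1] at hs
    have : χ s = 0 := by
      have hs1 : t + δ ≤ s := by rw [hm, min_eq_right h] at hs; exact hs.1
      have : (t - s) / δ + 1 ≤ 0 := by
        have : (t - s) / δ ≤ -1 := by rw [div_le_iff₀ hδ]; linarith
        linarith
      simp only [hχ]
      exact max_eq_left ((min_le_right _ _).trans this)
    simp only [this, zero_mul, integral_zero]
  rw [← intervalIntegral.integral_add_adjacent_intervals (ii 0 t) (ii t 1),
    ← intervalIntegral.integral_add_adjacent_intervals (ii t m) (ii m 1), e1, e2]
  simp only [add_zero, add_sub_cancel_left]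
  refine (intervalIntegral.norm_integral_le_of_norm_le_const (C := C) ?_).trans ?_
  · intro s hs
    rw [uIoc_of_le htm] at hs
    haveI := hβ.1 s
    refine norm_relInt_le fun a => ?_
    rw [norm_mul]
    have h1 : ‖χ s‖ ≤ 1 := by
      rw [Real.norm_of_nonneg (le_max_left _ _)]
      exact max_le zero_le_one (min_le_left _ _)
    have h2 := hC s ⟨ht.1.trans hs.1.le, hs.2.trans hm1⟩ a
    calc ‖χ s‖ * ‖g s a‖ ≤ 1 * C := mul_le_mul h1 h2 (norm_nonneg _) zero_le_one
      _ = C := one_mul _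
  · apply mul_le_mul_of_nonneg_left _ hC0
    rw [abs_of_nonneg (by linarith)]
    linarith [min_le_right 1 (t + δ)]

lemma wconv_t {β : ℕ → ℝ → Measure A} {β' : ℝ → Measure A} (hβ : ∀ n, IsRelaxedControl (β n))
    (hβ' : IsRelaxedControl β') (h : WConv β β') {g : ℝ → A → ℝ}
    (hg : Continuous (Function.uncurry g)) {t : ℝ} (ht : t ∈ Icc (0:ℝ) 1) :
    Tendsto (fun n => ∫ s in (0:ℝ)..t, ∫ a, g s a ∂(β n s)) atTop
          (𝓝 (∫ s in (0:ℝ)..t, ∫ a, g s a ∂(β' s))) := by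
  obtain ⟨C, hC0, hC⟩ := exists_bound_compact (isCompact_Icc (a := (0:ℝ)) (b := 1)) hg
  rw [Metric.tendsto_atTop]
  intro ε hε
  set δ := ε / (4 * (C + 1)) with hδd
  have hδ : 0 < δ := by positivity
  have hCδ : C * δ ≤ ε / 4 := by
    have : (C + 1) * δ = ε / 4 := by rw [hδd]; field_simp
    nlinarith
  have hgc : Continuous (Function.uncurry fun s a => (max 0 (min 1 ((t - s) / δ + 1))) * g s a) :=
    ((by fun_prop : Continuous fun s : ℝ => max 0 (min 1 ((t - s) / δ + 1))).comp
      continuous_fst).mul hg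
  obtain ⟨n0, hn0⟩ := (Metric.tendsto_atTop.1 (h _ hgc)) (ε / 4) (by positivity)
  refine ⟨n0, fun n hn => ?_⟩
  have h1 := cut_est (hβ n) hg hC ht hδ
  have h2 := cut_est hβ' hg hC ht hδ
  have h3 := hn0 n hn
  rw [Real.dist_eq] at h3 ⊢
  rw [Real.norm_eq_abs] at h1 h2
  rw [abs_le] at h1 h2
  rw [abs_lt] at h3 ⊢
  constructor <;> linarith [h1.1, h1.2, h2.1, h2.2, h3.1, h3.2]

lemma wconv_vec {β : ℕ → ℝ → Measure A} {β' : ℝ → Measure A} (hβ : ∀ n, IsRelaxedControl (β n))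
    (hβ' : IsRelaxedControl β') (h : WConv β β') {g : ℝ → A → EuclideanSpace ℝ (Fin N)}
    (hg : Continuous (Function.uncurry g)) {t : ℝ} (ht : t ∈ Icc (0:ℝ) 1) :
    Tendsto (fun n => ∫ s in (0:ℝ)..t, ∫ a, g s a ∂(β n s)) atTop
          (𝓝 (∫ s in (0:ℝ)..t, ∫ a, g s a ∂(β' s))) := by
  rw [(EuclideanSpace.equiv (Fin N) ℝ).toHomeomorph.isInducing.tendsto_nhds_iff]
  rw [tendsto_pi_nhds]
  intro i
  have key : ∀ b : ℝ → Measure A, IsRelaxedControl b →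
      (EuclideanSpace.equiv (Fin N) ℝ) (∫ s in (0:ℝ)..t, ∫ a, g s a ∂(b s)) i
        = ∫ s in (0:ℝ)..t, ∫ a, (g s a) i ∂(b s) := by
    intro b hb
    have e1 := ContinuousLinearMap.intervalIntegral_comp_comm
      (EuclideanSpace.proj i : EuclideanSpace ℝ (Fin N) →L[ℝ] ℝ)
      (relInt_intervalIntegrable hb hg 0 t)
    have e2 : ∀ s, (EuclideanSpace.proj i : EuclideanSpace ℝ (Fin N) →L[ℝ] ℝ) (∫ a, g s a ∂(b s))
        = ∫ a, (g s a) i ∂(b s) := by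
      intro s
      haveI := hb.1 s
      exact (ContinuousLinearMap.integral_comp_comm
        (EuclideanSpace.proj i : EuclideanSpace ℝ (Fin N) →L[ℝ] ℝ)
        (cont_integrable (hg.comp (Continuous.prodMk_right s)) (b s))).symm
    simp only [e2] at e1
    exact e1.symm
  have hgi : Continuous (Function.uncurry fun s a => (g s a) i) :=
    (EuclideanSpace.proj i : EuclideanSpace ℝ (Fin N) →L[ℝ] ℝ).continuous.comp hg
  have := wconv_t hβ hβ' h hgi ht
  simp only [← key β' hβ', ← fun n => key (β n) (hβ n)] at this
  exact this
end ClosedCost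

section LowerBound
variable {N : ℕ} {A : Type*} [MetricSpace A] [CompactSpace A] [MeasurableSpace A] [BorelSpace A]
  {f : EuclideanSpace ℝ (Fin N) → A → EuclideanSpace ℝ (Fin N)} {L : ℝ}
  {Y : EuclideanSpace ℝ (Fin N) → (ℝ → Measure A) → ℝ → EuclideanSpace ℝ (Fin N)}
  {ℓ : EuclideanSpace ℝ (Fin N) → A → ℝ}

/-- Gronwall with variable inhomogeneity. -/
lemma gronwall_var {φ a : ℝ → ℝ} (hφ : Continuous φ) (ha : Continuous a) (ha0 : ∀ t, 0 ≤ a t)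
    {L : ℝ} (hL : 0 < L)
    (h : ∀ t ∈ Icc (0:ℝ) 1, φ t ≤ a t + L * ∫ s in (0:ℝ)..t, φ s) :
    ∀ t ∈ Icc (0:ℝ) 1, φ t ≤ a t + (L * ∫ s in (0:ℝ)..1, a s) * Real.exp (L * t) := by
  intro t ht
  have := gronwall_int (φ := fun t => φ t - a t) (hφ.sub ha) (c := L * ∫ s in (0:ℝ)..1, a s)
    (b := 1) hL (fun t ht => by
      have h1 := h t ht
      have h2 : ∫ s in (0:ℝ)..t, (φ s - a s) = (∫ s in (0:ℝ)..t, φ s) - ∫ s in (0:ℝ)..t, a s :=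
        intervalIntegral.integral_sub (hφ.intervalIntegrable _ _) (ha.intervalIntegrable _ _)
      have h3 : ∫ s in (0:ℝ)..t, a s ≤ ∫ s in (0:ℝ)..1, a s := by
        rw [← intervalIntegral.integral_add_adjacent_intervals (ha.intervalIntegrable 0 t)
          (ha.intervalIntegrable t 1)]
        have := intervalIntegral.integral_nonneg (μ := volume) ht.2 (fun u _ => ha0 u)
        linarith
      rw [h2]
      nlinarith) t ht
  linarith

lemma traj_tendsto (S : Sys f L Y) {β : ℕ → ℝ → Measure A} {β' : ℝ → Measure A}
    (hβ : ∀ n, IsRelaxedControl (β n)) (hβ' : IsRelaxedControl β') (h : WConv β β')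
    {xs : ℕ → EuclideanSpace ℝ (Fin N)} {x : EuclideanSpace ℝ (Fin N)}
    (hx : Tendsto xs atTop (𝓝 x)) {t : ℝ} (ht : t ∈ Icc (0:ℝ) 1) :
    Tendsto (fun n => Y (xs n) (β n) t) atTop (𝓝 (Y x β' t)) := by
  set y := Y x β' with hy
  have hyc : Continuous y := S.cty hβ' x
  have hgc := comp_cont S.cont hyc
  obtain ⟨C, hC0, hC⟩ := exists_bound_compact (isCompact_Icc (a := (0:ℝ)) (b := 1)) hgc
  set E : (ℝ → Measure A) → ℝ → EuclideanSpace ℝ (Fin N) :=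
    fun b t => ∫ s in (0:ℝ)..t, ∫ a, f (y s) a ∂(b s) with hE
  have hEc : ∀ b, IsRelaxedControl b → Continuous (E b) := fun b hb =>
    intervalIntegral.continuous_primitive (fun p q => rel_ii S.cont hb hyc p q) 0
  have hEb : ∀ b, IsRelaxedControl b → ∀ t ∈ Icc (0:ℝ) 1, ‖E b t‖ ≤ C := by
    intro b hb t ht
    refine (intervalIntegral.norm_integral_le_of_norm_le_const (C := C) ?_).trans ?_
    · intro s hs
      rw [uIoc_of_le ht.1] at hs
      haveI := hb.1 s
      exact norm_relInt_le (hC s ⟨hs.1.le, hs.2.trans ht.2⟩)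
    · rw [sub_zero, abs_of_nonneg ht.1]
      exact mul_le_of_le_one_right hC0 ht.2
  set a : ℕ → ℝ → ℝ := fun n t => ‖xs n - x‖ + ‖E (β n) t - E β' t‖ with ha
  have hac : ∀ n, Continuous (a n) := fun n =>
    continuous_const.add ((hEc _ (hβ n)).sub (hEc _ hβ')).norm
  have hx0 : Tendsto (fun n => ‖xs n - x‖) atTop (𝓝 0) := by
    have := (hx.sub_const x).norm
    simpa using this
  have hat : ∀ t ∈ Icc (0:ℝ) 1, Tendsto (fun n => a n t) atTop (𝓝 0) := by
    intro t ht
    have h1 := wconv_vec hβ hβ' h hgc ht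
    have h2 := (h1.sub_const (E β' t)).norm
    have h3 := hx0.add h2
    simpa [ha, hE] using h3
  obtain ⟨D, hD⟩ := hx0.bddAbove_range
  have hai : Tendsto (fun n => ∫ s in (0:ℝ)..1, a n s) atTop (𝓝 0) := by
    have := intervalIntegral.tendsto_integral_filter_of_dominated_convergence
      (μ := volume) (a := 0) (b := 1) (l := atTop) (F := a) (f := fun _ => (0:ℝ))
      (fun _ => D + 2 * C)
      (Eventually.of_forall fun n => (hac n).aestronglyMeasurable)
      (Eventually.of_forall fun n => Eventually.of_forall fun s hs => by
        rw [uIoc_of_le zero_le_one] at hs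
        have hs' : s ∈ Icc (0:ℝ) 1 := ⟨hs.1.le, hs.2⟩
        rw [Real.norm_of_nonneg (by positivity)]
        have h1 := hD ⟨n, rfl⟩
        have h2 := norm_sub_le (E (β n) s) (E β' s)
        have h3 := hEb _ (hβ n) s hs'
        have h4 := hEb _ hβ' s hs'
        simp only [ha]
        simp only at h1
        linarith)
      intervalIntegrable_const
      (Eventually.of_forall fun s hs => by
        rw [uIoc_of_le zero_le_one] at hs
        exact hat s ⟨hs.1.le, hs.2⟩)
    simpa using this
  have hbound : ∀ n, ‖Y (xs n) (β n) t - y t‖ ≤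
      a n t + (L * ∫ s in (0:ℝ)..1, a n s) * Real.exp (L * t) := by
    intro n
    have hYc := S.cty (hβ n) (xs n)
    refine gronwall_var (φ := fun t => ‖Y (xs n) (β n) t - y t‖) (hYc.sub hyc).norm (hac n)
      (fun t => by positivity) S.pos (fun t ht => ?_) t ht
    have e1 := (S.traj (xs n) _ (hβ n)).2.2 t ht.1
    have e2 := (S.traj x _ hβ').2.2 t ht.1
    have i1 := rel_ii S.cont (hβ n) hYc 0 t
    have i2 := rel_ii S.cont (hβ n) hyc 0 t
    have e3 : Y (xs n) (β n) t - y t = (xs n - x) + (E (β n) t - E β' t) +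
        ∫ s in (0:ℝ)..t, ((∫ a, f (Y (xs n) (β n) s) a ∂(β n s)) - ∫ a, f (y s) a ∂(β n s)) := by
      rw [intervalIntegral.integral_sub i1 i2, e1, hy, e2]
      simp only [hE, hy]
      abel
    have e4 : ‖∫ s in (0:ℝ)..t, ((∫ a, f (Y (xs n) (β n) s) a ∂(β n s)) - ∫ a, f (y s) a ∂(β n s))‖
        ≤ ∫ s in (0:ℝ)..t, L * ‖Y (xs n) (β n) s - y s‖ := by
      apply intervalIntegral.norm_integral_le_of_norm_le ht.1
      · refine Eventually.of_forall fun s _ => ?_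
        haveI := (hβ n).1 s
        exact relInt_sub_le S _ _
      · exact (((hYc.sub hyc).norm).const_mul L).intervalIntegrable _ _
    rw [intervalIntegral.integral_const_mul] at e4
    rw [e3]
    refine (norm_add_le _ _).trans ?_
    refine add_le_add (norm_add_le _ _) ?_
    exact e4
  rw [tendsto_iff_norm_sub_tendsto_zero]
  have hlim : Tendsto (fun n => a n t + (L * ∫ s in (0:ℝ)..1, a n s) * Real.exp (L * t))
      atTop (𝓝 0) := by
    have := (hat t ht).add ((hai.const_mul L).mul_const (Real.exp (L * t)))
    simpa using this
  exact squeeze_zero (fun n => norm_nonneg _) hbound hlim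

lemma cost_tendsto (S : Sys f L Y)
    (hℓ : Continuous fun q : EuclideanSpace ℝ (Fin N) × A => ℓ q.1 q.2)
    {β : ℕ → ℝ → Measure A} {β' : ℝ → Measure A}
    (hβ : ∀ n, IsRelaxedControl (β n)) (hβ' : IsRelaxedControl β') (h : WConv β β')
    {xs : ℕ → EuclideanSpace ℝ (Fin N)} {x : EuclideanSpace ℝ (Fin N)}
    (hx : Tendsto xs atTop (𝓝 x)) :
    Tendsto (fun n => rcost ℓ (β n) (Y (xs n) (β n)) 1) atTop (𝓝 (rcost ℓ β' (Y x β') 1)) := by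
  set y := Y x β' with hy
  have hyc : Continuous y := S.cty hβ' x
  have hYc := fun n => S.cty (hβ n) (xs n)
  have h1 := h _ (comp_cont hℓ hyc)
  obtain ⟨D, hD⟩ := hx.norm.bddAbove_range
  obtain ⟨R, hR⟩ := S.growth (max D ‖x‖) 1 zero_le_one
  obtain ⟨C, hC0, hC⟩ := exists_bound_compact (isCompact_closedBall (0 : EuclideanSpace ℝ (Fin N)) R)
    (g := ℓ) hℓ
  have hin : ∀ n, ∀ s ∈ Icc (0:ℝ) 1, ∀ a, ‖ℓ (Y (xs n) (β n) s) a‖ ≤ C := fun n s hs a =>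
    hC _ (by simpa using hR (xs n) ((hD ⟨n, rfl⟩).trans (le_max_left _ _)) _ (hβ n) s hs) a
  have hin' : ∀ s ∈ Icc (0:ℝ) 1, ∀ a, ‖ℓ (y s) a‖ ≤ C := fun s hs a =>
    hC _ (by simpa using hR x (le_max_right _ _) _ hβ' s hs) a
  let ℓc : C(EuclideanSpace ℝ (Fin N), C(A, ℝ)) := ContinuousMap.curry ⟨_, hℓ⟩
  have h2 : Tendsto (fun n => ∫ s in (0:ℝ)..1,
      ((∫ a, ℓ (Y (xs n) (β n) s) a ∂(β n s)) - ∫ a, ℓ (y s) a ∂(β n s))) atTop (𝓝 0) := by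
    have := intervalIntegral.tendsto_integral_filter_of_dominated_convergence
      (μ := volume) (a := 0) (b := 1) (l := atTop)
      (F := fun n s => ((∫ a, ℓ (Y (xs n) (β n) s) a ∂(β n s)) - ∫ a, ℓ (y s) a ∂(β n s)))
      (f := fun _ => (0:ℝ))
      (fun _ => C + C)
      (Eventually.of_forall fun n =>
        ((relInt_stronglyMeasurable (hβ n) (comp_cont hℓ (hYc n))).sub
          (relInt_stronglyMeasurable (hβ n) (comp_cont hℓ hyc))).aestronglyMeasurable)
      (Eventually.of_forall fun n => Eventually.of_forall fun s hs => by
        rw [uIoc_of_le zero_le_one] at hs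
        have hs' : s ∈ Icc (0:ℝ) 1 := ⟨hs.1.le, hs.2⟩
        haveI := (hβ n).1 s
        exact (norm_sub_le _ _).trans (add_le_add (norm_relInt_le (hin n s hs'))
          (norm_relInt_le (hin' s hs'))))
      intervalIntegrable_const
      (Eventually.of_forall fun s hs => by
        rw [uIoc_of_le zero_le_one] at hs
        have hs' : s ∈ Icc (0:ℝ) 1 := ⟨hs.1.le, hs.2⟩
        have t1 := traj_tendsto S hβ hβ' h hx hs'
        have t2 := (ℓc.continuous.tendsto _).comp t1
        rw [tendsto_iff_norm_sub_tendsto_zero] at t2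
        refine squeeze_zero_norm (fun n => ?_) t2
        haveI := (hβ n).1 s
        rw [← integral_sub (cont_integrable (slice_cont hℓ _) _)
          (cont_integrable (slice_cont hℓ _) _)]
        refine norm_relInt_le fun a => ?_
        exact ContinuousMap.norm_coe_le_norm (ℓc (Y (xs n) (β n) s) - ℓc (y s)) a)
    simpa using this
  have h3 := h1.add h2
  rw [add_zero] at h3
  refine h3.congr fun n => ?_
  rw [intervalIntegral.integral_sub (rel_ii hℓ (hβ n) (hYc n) 0 1) (rel_ii hℓ (hβ n) hyc 0 1)]
  unfold rcost
  ring

lemma cost_lower (S : Sys f L Y)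
    (hℓ : Continuous fun q : EuclideanSpace ℝ (Fin N) × A => ℓ q.1 q.2)
    (hnn : ∀ x a, 0 ≤ ℓ x a) {T K : Set (EuclideanSpace ℝ (Fin N))}
    (hH5 : ∀ t > (0:ℝ), ∀ β, IsRelaxedControl β → ∀ x ∉ T, 0 < runCost ℓ β (Y x β) t)
    (hK : IsCompact K) (hKT : ∀ x ∈ K, x ∉ T) :
    ∃ c > 0, ∀ x ∈ K, ∀ β, IsRelaxedControl β → c ≤ rcost ℓ β (Y x β) 1 := by
  by_contra hcon
  push Not at hcon
  have : ∀ n : ℕ, ∃ x ∈ K, ∃ β, IsRelaxedControl β ∧ rcost ℓ β (Y x β) 1 < 1 / ((n:ℝ) + 1) :=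
    fun n => hcon _ (by positivity)
  choose xs hxs β hβ hlt using this
  obtain ⟨x, hxK, φ, hφ, hx⟩ := hK.tendsto_subseq hxs
  obtain ⟨β', hβ', ψ, hψ, hw⟩ := weak_lim (fun n => β (φ n)) (fun n => hβ _)
  have h1 := cost_tendsto S hℓ (β := fun n => β (φ (ψ n))) (fun n => hβ _) hβ' hw
    (xs := fun n => xs (φ (ψ n))) (hx.comp hψ.tendsto_atTop)
  have h2 : Tendsto (fun n : ℕ => 1 / (((φ (ψ n) : ℕ):ℝ) + 1)) atTop (𝓝 0) :=
    tendsto_one_div_add_atTop_nhds_zero_nat.comp (hφ.comp hψ).tendsto_atTop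
  have h3 := le_of_tendsto_of_tendsto' h1 h2 (fun n => (hlt _).le)
  have h4 := hH5 1 one_pos β' hβ' x (hKT x hxK)
  rw [runCost_eq hℓ hnn hβ' (S.cty hβ' x) zero_le_one, ENNReal.ofReal_pos] at h4
  linarith

end LowerBound

/-- The target can be reached from `x` with cost at most `c`. -/
def Reach {N : ℕ} {A : Type*} [MetricSpace A] [MeasurableSpace A]
    (T : Set (EuclideanSpace ℝ (Fin N))) (ℓ : EuclideanSpace ℝ (Fin N) → A → ℝ)
    (Y : EuclideanSpace ℝ (Fin N) → (ℝ → Measure A) → ℝ → EuclideanSpace ℝ (Fin N))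
    (x : EuclideanSpace ℝ (Fin N)) (c : ℝ) : Prop :=
  ∃ β, IsRelaxedControl β ∧ ∃ t, 0 ≤ t ∧ Y x β t ∈ T ∧ rcost ℓ β (Y x β) t ≤ c

section Assembly
variable {N : ℕ} {A : Type*} [MetricSpace A] [CompactSpace A] [MeasurableSpace A] [BorelSpace A]
  {f : EuclideanSpace ℝ (Fin N) → A → EuclideanSpace ℝ (Fin N)} {L : ℝ}
  {Y : EuclideanSpace ℝ (Fin N) → (ℝ → Measure A) → ℝ → EuclideanSpace ℝ (Fin N)}
  {ℓ : EuclideanSpace ℝ (Fin N) → A → ℝ} {T : Set (EuclideanSpace ℝ (Fin N))}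
  {w : EuclideanSpace ℝ (Fin N) → ℝ}

lemma exitTimes_bddBelow (y : ℝ → EuclideanSpace ℝ (Fin N)) : BddBelow (exitTimes T y) :=
  ⟨0, fun _ h => h.1⟩

lemma rcost_mono (S : Sys f L Y)
    (hℓ : Continuous fun q : EuclideanSpace ℝ (Fin N) × A => ℓ q.1 q.2)
    (hnn : ∀ x a, 0 ≤ ℓ x a) {β : ℝ → Measure A} (hβ : IsRelaxedControl β)
    (x : EuclideanSpace ℝ (Fin N)) {s t : ℝ} (hs : 0 ≤ s) (hst : s ≤ t) :
    rcost ℓ β (Y x β) s ≤ rcost ℓ β (Y x β) t := by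
  have := rcost_shift S hℓ hβ x hs (sub_nonneg.2 hst)
  rw [add_sub_cancel] at this
  rw [this]
  linarith [rcost_nonneg hnn (β := fun r => β (s + r)) (y := Y (Y x β s) (fun r => β (s + r)))
    (sub_nonneg.2 hst)]

lemma Reach.value_le (S : Sys f L Y)
    (hℓ : Continuous fun q : EuclideanSpace ℝ (Fin N) × A => ℓ q.1 q.2)
    (hnn : ∀ x a, 0 ≤ ℓ x a) {x : EuclideanSpace ℝ (Fin N)} {c : ℝ} (h : Reach T ℓ Y x c) :
    valueFn T ℓ Y x ≤ (c : EReal) := by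
  obtain ⟨β, hβ, t, ht, hT, hc⟩ := h
  have hmem : t ∈ exitTimes T (Y x β) := ⟨ht, hT⟩
  have hne : (exitTimes T (Y x β)).Nonempty := ⟨t, hmem⟩
  have h0 : 0 ≤ sInf (exitTimes T (Y x β)) := le_csInf hne fun _ h => h.1
  have hle : valueFn T ℓ Y x ≤
      ((runCost ℓ β (Y x β) (sInf (exitTimes T (Y x β))) : ℝ≥0∞) : EReal) := by
    unfold valueFn
    exact sInf_le ⟨β, hβ, hne, rfl⟩
  refine hle.trans ?_
  rw [runCost_eq hℓ hnn hβ (S.cty hβ x) h0, EReal.coe_ennreal_ofReal,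
    max_eq_left (rcost_nonneg hnn h0), EReal.coe_le_coe_iff]
  exact (rcost_mono S hℓ hnn hβ x h0 (csInf_le (exitTimes_bddBelow _) hmem)).trans hc

lemma Reach.prepend (S : Sys f L Y)
    (hℓ : Continuous fun q : EuclideanSpace ℝ (Fin N) × A => ℓ q.1 q.2)
    {x : EuclideanSpace ℝ (Fin N)} {c t : ℝ} {β : ℝ → Measure A} (hβ : IsRelaxedControl β)
    (ht : 0 ≤ t) (h : Reach T ℓ Y (Y x β t) c) :
    Reach T ℓ Y x (rcost ℓ β (Y x β) t + c) := by
  obtain ⟨β', hβ', s, hs, hT, hc⟩ := h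
  obtain ⟨e1, e2⟩ := cat_traj S ht hβ hβ' hℓ x hs
  refine ⟨cat t β β', cat_relaxed t hβ hβ', t + s, by linarith, ?_, ?_⟩
  · rw [e1]; exact hT
  · rw [e2]; linarith

lemma Reach.mono {x : EuclideanSpace ℝ (Fin N)} {c c' : ℝ} (h : Reach T ℓ Y x c) (hc : c ≤ c') :
    Reach T ℓ Y x c' := by
  obtain ⟨β, hβ, t, ht, hT, h⟩ := h
  exact ⟨β, hβ, t, ht, hT, h.trans hc⟩

lemma reach_near (S : Sys f L Y)
    (hℓ : Continuous fun q : EuclideanSpace ℝ (Fin N) × A => ℓ q.1 q.2)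
    (hw : Continuous w) (hwT : ∀ x ∈ T, w x = 0)
    (hSTC : ∀ ε > (0:ℝ), T ⊆ interior {x | ∃ t, 0 ≤ t ∧ t < ε ∧
        ∃ β, IsRelaxedControl β ∧ Y x β t ∈ T}) {ε : ℝ} (hε : 0 < ε) :
    T ⊆ interior {x | Reach T ℓ Y x (w x + ε)} := by
  intro z hz
  rw [mem_interior_iff_mem_nhds]
  obtain ⟨R, hR⟩ := S.growth (‖z‖ + 1) 1 zero_le_one
  obtain ⟨C, hC0, hC⟩ := exists_bound_compact (isCompact_closedBall (0 : EuclideanSpace ℝ (Fin N)) R)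
    (g := ℓ) hℓ
  have hδ : 0 < min 1 (ε / (2 * (C + 1))) := by positivity
  have h1 := mem_interior_iff_mem_nhds.1 (hSTC _ hδ hz)
  have h2 : ∀ᶠ x in 𝓝 z, -(ε / 2) < w x := by
    apply (hw.tendsto z).eventually_const_lt
    rw [hwT z hz]; linarith
  have h3 : ∀ᶠ x in 𝓝 z, x ∈ closedBall z 1 := closedBall_mem_nhds z one_pos
  filter_upwards [h1, h2, h3] with x hx1 hx2 hx3
  obtain ⟨t, ht0, htδ, β, hβ, hT⟩ := hx1
  refine ⟨β, hβ, t, ht0, hT, ?_⟩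
  have ht1 : t ≤ 1 := (htδ.trans_le (min_le_left _ _)).le
  have ht2 : t ≤ ε / (2 * (C + 1)) := (htδ.trans_le (min_le_right _ _)).le
  have hxn : ‖x‖ ≤ ‖z‖ + 1 := by
    rw [mem_closedBall, dist_eq_norm] at hx3
    have := norm_sub_norm_le x z
    linarith
  have hb : ‖rcost ℓ β (Y x β) t‖ ≤ C * |t - 0| := by
    refine intervalIntegral.norm_integral_le_of_norm_le_const fun s hs => ?_
    rw [uIoc_of_le ht0] at hs
    haveI := hβ.1 s
    exact norm_relInt_le (hC _ (by simpa using hR x hxn β hβ s ⟨hs.1.le, hs.2.trans ht1⟩))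
  rw [sub_zero, abs_of_nonneg ht0] at hb
  have h4 : C * t ≤ ε / 2 := by
    calc C * t ≤ (C + 1) * (ε / (2 * (C + 1))) := by gcongr; linarith
      _ = ε / 2 := by field_simp
  have := Real.le_norm_self (rcost ℓ β (Y x β) t)
  linarith

lemma reach_main [Nonempty A] (S : Sys f L Y)
    (hℓ : Continuous fun q : EuclideanSpace ℝ (Fin N) × A => ℓ q.1 q.2)
    (hnn : ∀ x a, 0 ≤ ℓ x a) (hT : IsClosed T)
    (hw : Continuous w) (hwT : ∀ x ∈ T, w x = 0)
    (hsol : IsViscositySol (HJB f ℓ) Tᶜ w) (hbb : BddBelow (range w))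
    (hSTC : ∀ ε > (0:ℝ), T ⊆ interior {x | ∃ t, 0 ≤ t ∧ t < ε ∧
        ∃ β, IsRelaxedControl β ∧ Y x β t ∈ T})
    (hH5 : ∀ t > (0:ℝ), ∀ β, IsRelaxedControl β → ∀ x ∉ T, 0 < runCost ℓ β (Y x β) t)
    (hH6 : ∀ x β, IsRelaxedControl β →
        (∀ M : ℝ, ∀ t : ℝ, ∃ s, t ≤ s ∧ M < ‖Y x β s‖) →
        (∫⁻ s in Ioi (0:ℝ), ENNReal.ofReal (∫ a, ℓ (Y x β s) a ∂(β s))) = ⊤)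
    (x : EuclideanSpace ℝ (Fin N)) {ε : ℝ} (hε : 0 < ε) :
    Reach T ℓ Y x (w x + 2 * ε) := by
  by_contra hnot
  set U := interior {x | Reach T ℓ Y x (w x + ε)} with hUdef
  have hU : IsOpen U := isOpen_interior
  have hTU : T ⊆ U := reach_near S hℓ hw hwT hSTC hε
  obtain ⟨m, hm⟩ := hbb
  have D : ∀ t, 0 ≤ t → ∀ B, IsRelaxedControl B →
      w (Y x B t) + rcost ℓ B (Y x B) t ≤ w x + ε → Y x B t ∉ U := by
    intro t ht B hB h hin
    have h1 : Reach T ℓ Y (Y x B t) (w (Y x B t) + ε) := by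
      have h2 := interior_subset hin
      exact h2
    exact hnot ((h1.prepend S hℓ hB ht).mono (by linarith))
  have hstep : ∀ (k : ℕ) (z : EuclideanSpace ℝ (Fin N)), ∃ β, IsRelaxedControl β ∧
      ∃ t ∈ Icc (0:ℝ) 1, (t = 1 ∨ Y z β t ∈ U) ∧
      w (Y z β t) + rcost ℓ β (Y z β) t ≤ w z + ε / 2 ^ (k + 1) :=
    fun k z => supopt S hℓ hT hw hsol hU hTU (by positivity) z
  choose b hb τ hτ hτ1 hτ2 using hstep
  let xs : ℕ → EuclideanSpace ℝ (Fin N) := fun k => Nat.rec x (fun k z => Y z (b k z) 1) k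
  let β : ℕ → ℝ → Measure A := fun k => b k (xs k)
  have hβ : ∀ k, IsRelaxedControl (β k) := fun k => hb _ _
  have hxs : ∀ k, xs (k + 1) = Y (xs k) (β k) 1 := fun k => rfl
  have hx0 : xs 0 = x := rfl
  set B := icat 1 β with hBdef
  have hB : IsRelaxedControl B := icat_relaxed 1 hβ
  have tr := icat_traj S one_pos hβ hℓ hxs
  rw [hx0, ← hBdef] at tr
  simp only [mul_one] at tr
  have hind : ∀ k : ℕ, w (xs k) + rcost ℓ B (Y x B) k ≤ w x + ε * (1 - 1 / 2 ^ k) := by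
    intro k
    induction k with
    | zero => simp [hx0, rcost]
    | succ k ih =>
      obtain ⟨e1, e2⟩ := (tr k).2 (τ k (xs k)) (hτ k (xs k))
      have h1 := hτ2 k (xs k)
      have hp : (0:ℝ) < 1 / 2 ^ (k + 1) := by positivity
      have hq : (1:ℝ) / 2 ^ k = 2 * (1 / 2 ^ (k + 1)) := by rw [pow_succ]; field_simp
      have hq2 : ε / 2 ^ (k + 1) = ε * (1 / 2 ^ (k + 1)) := by ring
      rw [hq] at ih
      rw [hq2] at h1
      have h2 : w (Y x B (k + τ k (xs k))) + rcost ℓ B (Y x B) (k + τ k (xs k)) ≤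
          w x + ε * (1 - 1 / 2 ^ (k + 1)) := by
        rw [e1, e2]
        simp only [β] at h1 ⊢
        linarith
      have h3 := D (k + τ k (xs k)) (add_nonneg k.cast_nonneg (hτ k (xs k)).1) B hB
        (h2.trans (by nlinarith))
      have h4 : τ k (xs k) = 1 := by
        rcases hτ1 k (xs k) with h | h
        · exact h
        · rw [e1] at h3; exact absurd h h3
      rw [h4] at h2
      have e3 := (tr (k + 1)).1
      push_cast at e3 ⊢
      rw [e3] at h2
      exact h2
  have hcost : ∀ k : ℕ, rcost ℓ B (Y x B) k ≤ w x + ε - m := by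
    intro k
    have h1 := hind k
    have h2 : m ≤ w (xs k) := hm ⟨_, rfl⟩
    have h3 : (0:ℝ) < 1 / 2 ^ k := by positivity
    nlinarith
  have hnU : ∀ k : ℕ, xs k ∉ U := by
    intro k
    have h1 := hind k
    have h3 : (0:ℝ) < 1 / 2 ^ k := by positivity
    have := D k k.cast_nonneg B hB (by rw [(tr k).1]; nlinarith)
    rwa [(tr k).1] at this
  have hfin : (∫⁻ s in Ioi (0:ℝ), ENNReal.ofReal (∫ a, ℓ (Y x B s) a ∂(B s))) ≠ ⊤ := by
    have hun : (⋃ n : ℕ, Ioc (0:ℝ) n) = Ioi 0 := by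
      ext s
      simp only [mem_iUnion, mem_Ioc, mem_Ioi]
      constructor
      · rintro ⟨n, h, _⟩; exact h
      · intro h; obtain ⟨n, hn⟩ := exists_nat_ge s; exact ⟨n, h, hn⟩
    rw [← hun, setLIntegral_iUnion_of_directed]
    · refine ne_top_of_le_ne_top (ENNReal.ofReal_ne_top (r := w x + ε - m)) (iSup_le fun n => ?_)
      have := runCost_eq hℓ hnn hB (S.cty hB x) (t := (n:ℝ)) n.cast_nonneg
      unfold runCost at this
      rw [this]
      exact ENNReal.ofReal_le_ofReal (hcost n)
    · exact Monotone.directed_le fun p q h => Ioc_subset_Ioc_right (by exact_mod_cast h)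
  have hbd : ¬ (∀ M : ℝ, ∀ t : ℝ, ∃ s, t ≤ s ∧ M < ‖Y x B s‖) := fun h => hfin (hH6 x B hB h)
  push Not at hbd
  obtain ⟨M, t0, hMt⟩ := hbd
  obtain ⟨k0, hk0⟩ := exists_nat_ge t0
  obtain ⟨c, hc0, hc⟩ := cost_lower S hℓ hnn hH5
    ((isCompact_closedBall (0 : EuclideanSpace ℝ (Fin N)) M).diff hU)
    (fun z hz hzT => hz.2 (hTU hzT))
  have hgrow : ∀ j : ℕ, j * c ≤ rcost ℓ B (Y x B) ((k0 + j : ℕ) : ℝ) := by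
    intro j
    induction j with
    | zero => simpa using rcost_nonneg hnn (Nat.cast_nonneg k0)
    | succ j ih =>
      obtain ⟨e1, e2⟩ := (tr (k0 + j)).2 1 ⟨zero_le_one, le_rfl⟩
      have hin : xs (k0 + j) ∈ closedBall (0 : EuclideanSpace ℝ (Fin N)) M \ U := by
        refine ⟨?_, hnU _⟩
        rw [← (tr (k0 + j)).1]
        simpa using hMt ((k0 + j : ℕ) : ℝ) (hk0.trans (by push_cast; linarith [j.cast_nonneg (α := ℝ)]))
      have h1 := hc _ hin _ (hβ (k0 + j))
      have e3 : ((k0 + (j + 1) : ℕ) : ℝ) = ((k0 + j : ℕ) : ℝ) + 1 := by push_cast; ring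
      rw [e3, e2]
      push_cast
      push_cast at ih
      linarith
  obtain ⟨j, hj⟩ := exists_nat_gt ((w x + ε - m) / c)
  rw [div_lt_iff₀ hc0] at hj
  linarith [hgrow j, hcost (k0 + j)]

lemma le_value (S : Sys f L Y)
    (hℓ : Continuous fun q : EuclideanSpace ℝ (Fin N) × A => ℓ q.1 q.2)
    (hnn : ∀ x a, 0 ≤ ℓ x a) (hT : IsClosed T)
    (hw : Continuous w) (hwT : ∀ x ∈ T, w x = 0)
    (hsol : IsViscositySol (HJB f ℓ) Tᶜ w) (x : EuclideanSpace ℝ (Fin N)) :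
    (w x : EReal) ≤ valueFn T ℓ Y x := by
  refine le_sInf ?_
  rintro _ ⟨β, hβ, hne, rfl⟩
  have hy := S.cty hβ x
  set τ := sInf (exitTimes T (Y x β)) with hτ
  have h0 : 0 ≤ τ := le_csInf hne fun _ h => h.1
  have hcl : IsClosed (exitTimes T (Y x β)) := isClosed_Ici.inter (hT.preimage hy)
  have hmem : τ ∈ exitTimes T (Y x β) := hcl.csInf_mem hne (exitTimes_bddBelow _)
  rw [runCost_eq hℓ hnn hβ hy h0, EReal.coe_ennreal_ofReal,
    max_eq_left (rcost_nonneg hnn h0), EReal.coe_le_coe_iff]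
  rcases eq_or_lt_of_le h0 with h | h
  · have : x ∈ T := by
      have := hmem.2
      rwa [← h, S.zero hβ x] at this
    rw [hwT x this]
    exact rcost_nonneg hnn h0
  · have hlim : Tendsto (fun t => rcost ℓ β (Y x β) τ + w (Y x β t)) (𝓝[<] τ)
        (𝓝 (rcost ℓ β (Y x β) τ + w (Y x β τ))) :=
      ((continuous_const.add (hw.comp hy)).tendsto τ).mono_left nhdsWithin_le_nhds
    rw [hwT _ hmem.2, add_zero] at hlim
    refine ge_of_tendsto hlim ?_
    filter_upwards [Ioo_mem_nhdsLT h] with t ht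
    have h1 := subopt S hℓ hnn hT hw hsol hβ x ht.1 (fun s hs hsT =>
      not_lt.2 (csInf_le (exitTimes_bddBelow _) ⟨hs.1, hsT⟩) (hs.2.trans_lt ht.2))
    have h2 := rcost_mono S hℓ hnn hβ x ht.1.le ht.2.le
    linarith

end Assembly

/-- the main uniqueness theorem.  Under `(STCT)`, `(H₅)`, `(H₆)`, any
continuous bounded-from-below viscosity solution `w` of the HJBE on `ℝ^N ∖ T`
vanishing on `T` coincides with the value function `v`. -/
theorem main_uniqueness {N : ℕ} {A : Type*} [MetricSpace A] [CompactSpace A] [Nonempty A]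
    [MeasurableSpace A] [BorelSpace A]
    (T : Set (EuclideanSpace ℝ (Fin N))) (hTcl : IsClosed T) (hTne : T.Nonempty)
    (f : EuclideanSpace ℝ (Fin N) → A → EuclideanSpace ℝ (Fin N))
    (hf : Continuous fun q : EuclideanSpace ℝ (Fin N) × A => f q.1 q.2)
    (L : ℝ) (hL : 0 < L)
    (hfLip : ∀ x y a, ‖f x a - f y a‖ ≤ L * ‖x - y‖)
    (ℓ : EuclideanSpace ℝ (Fin N) → A → ℝ)
    (hℓ : Continuous fun q : EuclideanSpace ℝ (Fin N) × A => ℓ q.1 q.2)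
    (hℓnn : ∀ x a, 0 ≤ ℓ x a)
    -- the trajectory map: `Y x β` is the unique solution of `ẏ = f^r(y, β)`, `y 0 = x`
    (Y : EuclideanSpace ℝ (Fin N) → (ℝ → Measure A) → ℝ → EuclideanSpace ℝ (Fin N))
    (hY : ∀ x β, IsRelaxedControl β → IsTrajectory f β x (Y x β))
    -- (STCT): small-time controllability to the target
    (hSTC : ∀ ε > (0:ℝ), T ⊆ interior {x | ∃ t, 0 ≤ t ∧ t < ε ∧
        ∃ β, IsRelaxedControl β ∧ Y x β t ∈ T})
    -- (H₅): positivity of running costs outside the target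
    (hH5 : ∀ t > (0:ℝ), ∀ β, IsRelaxedControl β → ∀ x ∉ T,
        0 < runCost ℓ β (Y x β) t)
    -- (H₆): trajectories with `limsup_{s→∞} ‖y(s)‖ = ∞` have infinite total cost
    (hH6 : ∀ x β, IsRelaxedControl β →
        (∀ M : ℝ, ∀ t : ℝ, ∃ s, t ≤ s ∧ M < ‖Y x β s‖) →
        (∫⁻ s in Ioi (0:ℝ), ENNReal.ofReal (∫ a, ℓ (Y x β s) a ∂(β s))) = ⊤)
    (w : EuclideanSpace ℝ (Fin N) → ℝ) (hw : Continuous w)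
    (hsol : IsViscositySol (HJB f ℓ) Tᶜ w)
    (hbb : BddBelow (range w))
    (hwT : ∀ x ∈ T, w x = 0) :
    ∀ x, (w x : EReal) = valueFn T ℓ Y x := by
  intro x
  have S : Sys f L Y := ⟨hf, hL, hfLip, hY⟩
  refine le_antisymm (le_value S hℓ hℓnn hTcl hw hwT hsol x) ?_
  refine EReal.le_of_forall_lt_iff_le.1 fun z hz => ?_
  rw [EReal.coe_lt_coe_iff] at hz
  have h := reach_main S hℓ hℓnn hTcl hw hwT hsol hbb hSTC hH5 hH6 x
    (ε := (z - w x) / 2) (by linarith)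
  refine (h.value_le S hℓ hℓnn).trans ?_
  rw [EReal.coe_le_coe_iff]
  linarith
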